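/- arXiv:2212.10119 — 3 statements merged into one kernel-verified Lean document; each statement's English description precedes it below -/
import Mathlib

section
/- Let 𝒜 ⊆ ℂ^N be an irreducible algebraic set of positive dimension (equivalently, infinite) and let f : 𝒜 → ℂ^M be a proper polynomial mapping on 𝒜 which is surjective onto ℂ^M (f(𝒜) = ℂ^M). Assume that the limit d := lim_{𝒜∋z→∞} log‖f(z)‖/log‖z‖ exists in ℝ (equivalently, L∞(f|𝒜) = ρ(f,𝒜) = d). Then for every nonempty compact set K ⊆ ℂ^M and every z ∈ 𝒜: V_K(f(z)) = d · V_{f⁻¹(K)}(z) (with the convention t·(+∞) = +∞ for t > 0). -/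
open Filter MvPolynomial Metric Set ENNReal

/-- extended logarithm of a nonnegative real number, with `elog 0 = -∞`. -/
noncomputable def elog (t : ℝ) : EReal := if t = 0 then ⊥ else ((Real.log t : ℝ) : EReal)

/-- the filter of points of `V` whose norm tends to infinity. -/
def atInftyOn {E : Type*} [Norm E] (V : Set E) : Filter E :=
  (Filter.comap (fun z => ‖z‖) Filter.atTop) ⊓ Filter.principal V

/-- the quotient `log ‖f z‖ / log ‖z‖`, computed in the extended reals. -/
noncomputable def logRatio {E F : Type*} [Norm E] [Norm F] (f : E → F) (z : E) : EReal :=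
  elog ‖f z‖ / elog ‖z‖

/-- the growth exponent `ρ(f, V)` of `f` on `V`. -/
noncomputable def growthExp {E F : Type*} [Norm E] [Norm F] (f : E → F) (V : Set E) : EReal :=
  Filter.limsup (logRatio f) (atInftyOn V)

/-- `log ‖f⁻¹(w)‖ = log sup {‖z‖ : z ∈ V, f z = w}`, computed in the extended reals
(`-∞` for an empty fiber). -/
noncomputable def fiberLogNorm {E F : Type*} [Norm E] [Norm F] (f : E → F) (V : Set E)
    (w : F) : EReal :=
  sSup ((fun z => elog ‖z‖) '' {z | z ∈ V ∧ f z = w})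

/-- the order `ρ(f⁻¹, f(V))` of `f` on `V`: the growth exponent of the multifunction `f⁻¹`
on `f(V)`. -/
noncomputable def orderExp {E F : Type*} [Norm E] [Norm F] (f : E → F) (V : Set E) : EReal :=
  Filter.limsup (fun w => fiberLogNorm f V w / elog ‖w‖) (atInftyOn (f '' V))

/-- the Łojasiewicz exponent at infinity `L∞(f|V)`, with `sup ∅ = -∞`. -/
noncomputable def lojExp {E F : Type*} [Norm E] [Norm F] (f : E → F) (V : Set E) : EReal :=
  sSup {x : EReal | ∃ d : ℝ, x = (d : EReal) ∧
    ∃ C : ℝ, 0 < C ∧ ∃ R : ℝ, 0 < R ∧ ∀ z ∈ V, R < ‖z‖ → C * ‖z‖ ^ d < ‖f z‖}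

/-- inverse on `[0,+∞] ⊆ EReal` with the conventions `1/∞ = 0` and `1/0 = ∞`. -/
noncomputable def invE (x : EReal) : EReal :=
  if x = ⊤ then 0 else if x = 0 then ⊤ else (((x.toReal)⁻¹ : ℝ) : EReal)

/-- evaluation of a polynomial of `n` variables at a point of `ℂⁿ`. -/
noncomputable def evalAt {n : ℕ} (z : EuclideanSpace ℂ (Fin n))
    (p : MvPolynomial (Fin n) ℂ) : ℂ :=
  MvPolynomial.eval (fun i => z i) p

/-- an algebraic subset of `ℂⁿ`: the common zero set of finitely many polynomials. -/
def IsAlgebraicSet {n : ℕ} (A : Set (EuclideanSpace ℂ (Fin n))) : Prop :=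
  ∃ S : Finset (MvPolynomial (Fin n) ℂ), A = {z | ∀ p ∈ S, evalAt z p = 0}

/-- the ideal of all polynomials vanishing identically on `A`. -/
noncomputable def vanishIdeal {n : ℕ} (A : Set (EuclideanSpace ℂ (Fin n))) :
    Ideal (MvPolynomial (Fin n) ℂ) :=
  RingHom.ker (Pi.ringHom fun z : A =>
    MvPolynomial.eval (fun i => (z : EuclideanSpace ℂ (Fin n)) i))

/-- a polynomial mapping on `A`: the restriction to `A` of a mapping all of whose
components are polynomials. -/
def IsPolyMapOn {N M : ℕ} (f : EuclideanSpace ℂ (Fin N) → EuclideanSpace ℂ (Fin M))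
    (A : Set (EuclideanSpace ℂ (Fin N))) : Prop :=
  ∃ P : Fin M → MvPolynomial (Fin N) ℂ, ∀ z ∈ A, ∀ j, f z j = evalAt z (P j)

/-- a holomorphic mapping on `A`: locally the restriction of a holomorphic mapping on an
open subset of the ambient space. -/
def IsHoloOn {N M : ℕ} (f : EuclideanSpace ℂ (Fin N) → EuclideanSpace ℂ (Fin M))
    (A : Set (EuclideanSpace ℂ (Fin N))) : Prop :=
  ∀ z ∈ A, ∃ U : Set (EuclideanSpace ℂ (Fin N)), IsOpen U ∧ z ∈ U ∧
    ∃ F : EuclideanSpace ℂ (Fin N) → EuclideanSpace ℂ (Fin M),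
      DifferentiableOn ℂ F U ∧ Set.EqOn f F (U ∩ A)

/-- the pluricomplex Green function of a compact set `K ⊆ ℂⁿ`, in its Siciak–Zaharjuta
polynomial form `V_K(z) = sup { (deg q)⁻¹ · log⁺ |q(z)| }`. -/
noncomputable def greenV {n : ℕ} (K : Set (EuclideanSpace ℂ (Fin n)))
    (z : EuclideanSpace ℂ (Fin n)) : EReal :=
  sSup {x : EReal | ∃ q : MvPolynomial (Fin n) ℂ, 1 ≤ q.totalDegree ∧
    (∀ w ∈ K, ‖evalAt w q‖ ≤ 1) ∧
    x = (((q.totalDegree : ℝ)⁻¹ * max (Real.log ‖evalAt z q‖) 0 : ℝ) : EReal)}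



/-- substitution homomorphism `ℂ[w][T] → ℂ[z]`. -/
noncomputable def substHom {n r : ℕ} (G : Fin r → MvPolynomial (Fin n) ℂ)
    (h : MvPolynomial (Fin n) ℂ) :
    Polynomial (MvPolynomial (Fin r) ℂ) →+* MvPolynomial (Fin n) ℂ :=
  Polynomial.eval₂RingHom (MvPolynomial.aeval G : MvPolynomial (Fin r) ℂ →ₐ[ℂ] _).toRingHom h

/-- evaluation homomorphism `ℂ[w][T] → ℂ`. -/
noncomputable def evHom {r : ℕ} (w : Fin r → ℂ) (t : ℂ) :
    Polynomial (MvPolynomial (Fin r) ℂ) →+* ℂ :=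
  Polynomial.eval₂RingHom (MvPolynomial.eval w) t

lemma eval_substHom {n r : ℕ} (G : Fin r → MvPolynomial (Fin n) ℂ)
    (h : MvPolynomial (Fin n) ℂ) (x : Fin n → ℂ) (p : Polynomial (MvPolynomial (Fin r) ℂ)) :
    MvPolynomial.eval x (substHom G h p)
      = evHom (fun i => MvPolynomial.eval x (G i)) (MvPolynomial.eval x h) p := by
  have : (MvPolynomial.eval x).comp (substHom G h)
      = evHom (fun i => MvPolynomial.eval x (G i)) (MvPolynomial.eval x h) := by
    apply Polynomial.ringHom_ext
    · intro a
      simp only [substHom, evHom, RingHom.comp_apply, Polynomial.coe_eval₂RingHom,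
        Polynomial.eval₂_C]
      have : (MvPolynomial.eval x).comp (MvPolynomial.aeval G : MvPolynomial (Fin r) ℂ →ₐ[ℂ] _).toRingHom
          = MvPolynomial.eval (fun i => MvPolynomial.eval x (G i)) := by
        apply MvPolynomial.ringHom_ext
        · intro r; simp
        · intro i; simp
      exact congrArg (fun φ => φ a) this
    · simp [substHom, evHom]
  exact congrArg (fun φ => φ p) this

lemma evHom_eq {r : ℕ} (w : Fin r → ℂ) (t : ℂ) (p : Polynomial (MvPolynomial (Fin r) ℂ)) :
    evHom w t p = (p.map (MvPolynomial.eval w)).eval t := by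
  simp [evHom, Polynomial.eval₂_eq_eval_map]

lemma generic_lift {n r : ℕ} (I : Ideal (MvPolynomial (Fin n) ℂ)) (hI : I.IsPrime)
    (G : Fin r → MvPolynomial (Fin n) ℂ) (h : MvPolynomial (Fin n) ℂ) :
    ∃ D : Polynomial (MvPolynomial (Fin r) ℂ), substHom G h D ∉ I ∧
      ∀ (w : Fin r → ℂ) (t : ℂ), (∀ p, substHom G h p ∈ I → evHom w t p = 0) →
        evHom w t D ≠ 0 → ∃ x : Fin n → ℂ, (∀ p ∈ I, MvPolynomial.eval x p = 0) ∧
          (∀ i, MvPolynomial.eval x (G i) = w i) ∧ MvPolynomial.eval x h = t := by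
  set ψ : Polynomial (MvPolynomial (Fin r) ℂ) →+* (MvPolynomial (Fin n) ℂ ⧸ I) :=
    (Ideal.Quotient.mk I).comp (substHom G h) with hψ
  have hψ0 : ∀ p, ψ p = 0 ↔ substHom G h p ∈ I := fun p => by
    simp [hψ, Ideal.Quotient.eq_zero_iff_mem]
  have hft : ψ.FiniteType := by
    apply RingHom.FiniteType.of_comp_finiteType
      (f := (Polynomial.C : _ →+* Polynomial (MvPolynomial (Fin r) ℂ)).comp (MvPolynomial.C : ℂ →+* _))
    have : (ψ.comp ((Polynomial.C : _ →+* Polynomial (MvPolynomial (Fin r) ℂ)).comp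
        (MvPolynomial.C : ℂ →+* _))) = algebraMap ℂ (MvPolynomial (Fin n) ℂ ⧸ I) := by
      ext a
      simp [hψ, substHom]
      rfl
    rw [this, RingHom.finiteType_algebraMap]
    infer_instance
  have hfp : ψ.FinitePresentation := RingHom.FinitePresentation.of_finiteType.mp hft
  have hc := PrimeSpectrum.isConstructible_range_comap hfp
  obtain ⟨S, hS⟩ := PrimeSpectrum.exists_constructibleSetData_iff.mpr hc
  have hmem : PrimeSpectrum.comap ψ ⟨⊥, Ideal.isPrime_bot⟩ ∈ S.toSet := by
    rw [hS]; exact ⟨_, rfl⟩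
  simp only [PrimeSpectrum.ConstructibleSetData.toSet, Set.mem_iUnion] at hmem
  obtain ⟨C, hC, hm1, hm2⟩ := hmem
  refine ⟨C.f, ?_, ?_⟩
  · intro hcf
    apply hm2
    simp [PrimeSpectrum.mem_zeroLocus, (hψ0 _).2 hcf]
  · intro w t hw hD
    have hp : (⟨RingHom.ker (evHom w t), RingHom.ker_isPrime _⟩ : PrimeSpectrum _) ∈ S.toSet := by
      simp only [PrimeSpectrum.ConstructibleSetData.toSet, Set.mem_iUnion]
      refine ⟨C, hC, ?_, ?_⟩
      · rintro _ ⟨i, rfl⟩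
        have := hm1 ⟨i, rfl⟩
        simp at this
        exact hw _ ((hψ0 _).1 this)
      · intro hh
        apply hD
        simpa using hh
    rw [hS] at hp
    obtain ⟨q, hq⟩ := hp
    obtain ⟨m, hm, hqm⟩ := Ideal.exists_le_maximal q.asIdeal q.2.ne_top
    have hmm : (m.comap (Ideal.Quotient.mk I)).IsMaximal :=
      Ideal.comap_isMaximal_of_surjective _ Ideal.Quotient.mk_surjective
    obtain ⟨x, hx⟩ := MvPolynomial.isMaximal_iff_eq_vanishingIdeal_singleton.1 hmm
    have hx' : ∀ p, Ideal.Quotient.mk I p ∈ m ↔ MvPolynomial.eval x p = 0 := by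
      intro p
      rw [← Ideal.mem_comap, hx]
      simp
    have key : ∀ p, evHom w t p = 0 → MvPolynomial.eval x (substHom G h p) = 0 := by
      intro p hp
      rw [← hx']
      apply hqm
      have : p ∈ (PrimeSpectrum.comap ψ q).asIdeal := by rw [hq]; exact hp
      exact this
    refine ⟨x, ?_, ?_, ?_⟩
    · intro p hp
      rw [← hx', Ideal.Quotient.eq_zero_iff_mem.2 hp]
      exact m.zero_mem
    · intro i
      have := key (Polynomial.C (MvPolynomial.X i - MvPolynomial.C (w i))) (by simp [evHom])
      simpa [substHom, sub_eq_zero] using this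
    · have := key (Polynomial.X - Polynomial.C (MvPolynomial.C t)) (by simp [evHom])
      simpa [substHom, sub_eq_zero] using this


lemma evalAt_continuous {n : ℕ} (p : MvPolynomial (Fin n) ℂ) :
    Continuous (fun z : EuclideanSpace ℂ (Fin n) => evalAt z p) := by
  unfold evalAt
  have := MvPolynomial.continuous_eval p
  exact this.comp (by fun_prop)

lemma evalAt_growth {n : ℕ} (p : MvPolynomial (Fin n) ℂ) :
    ∃ C : ℝ, 0 < C ∧ ∀ z : EuclideanSpace ℂ (Fin n),
      ‖evalAt z p‖ ≤ C * (1 + ‖z‖) ^ p.totalDegree := by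
  refine ⟨1 + ∑ m ∈ p.support, ‖p.coeff m‖, by positivity, fun z => ?_⟩
  have h1 : ‖evalAt z p‖ ≤ ∑ m ∈ p.support, ‖p.coeff m‖ * (1 + ‖z‖) ^ p.totalDegree := by
    unfold evalAt
    rw [MvPolynomial.eval_eq']
    refine (norm_sum_le _ _).trans (Finset.sum_le_sum fun m hm => ?_)
    rw [norm_mul]
    gcongr
    rw [norm_prod]
    calc ∏ i, ‖z i ^ m i‖ ≤ ∏ i, (1 + ‖z‖) ^ m i := by
          gcongr with i
          rw [norm_pow]
          gcongr
          have := EuclideanSpace.norm_eq z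
          have h2 : ‖z i‖ ≤ ‖z‖ := PiLp.norm_apply_le z i
          linarith
      _ = (1 + ‖z‖) ^ (∑ i, m i) := by rw [Finset.prod_pow_eq_pow_sum]
      _ ≤ (1 + ‖z‖) ^ p.totalDegree := by
          apply pow_le_pow_right₀ (by linarith [norm_nonneg z])
          have := MvPolynomial.le_totalDegree hm
          rwa [Finsupp.sum_fintype _ _ (by simp)] at this
  rw [← Finset.sum_mul] at h1
  refine h1.trans ?_
  gcongr
  linarith

lemma evalAt_smul {n : ℕ} (p : MvPolynomial (Fin n) ℂ) (c : ℂ) (v : EuclideanSpace ℂ (Fin n)) :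
    evalAt (c • v) p = ∑ i ∈ Finset.range (p.totalDegree + 1),
      c ^ i * evalAt v (MvPolynomial.homogeneousComponent i p) := by
  have h := MvPolynomial.sum_homogeneousComponent p
  have h2 : ∀ i, evalAt (c • v) (MvPolynomial.homogeneousComponent i p)
      = c ^ i * evalAt v (MvPolynomial.homogeneousComponent i p) := by
    intro i
    have := (MvPolynomial.homogeneousComponent_isHomogeneous i p)
    unfold evalAt
    have h3 : (fun j => (c • v) j) = c • (fun j => v j) := by ext j; simp
    rw [h3]
    rw [MvPolynomial.eval_eq', MvPolynomial.eval_eq', Finset.mul_sum]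
    refine Finset.sum_congr rfl fun m hm => ?_
    have hd := this (MvPolynomial.mem_support_iff.1 hm)
    simp only [Pi.smul_apply, smul_eq_mul, mul_pow, Finset.prod_mul_distrib]
    rw [Finset.prod_pow_eq_pow_sum]
    have : ∑ j, m j = i := by
      rw [← hd, Finsupp.weight_apply, Finsupp.sum_fintype _ _ (by simp)]; simp
    rw [this]; ring
  conv_lhs => rw [← h]
  unfold evalAt at *
  rw [map_sum]
  exact Finset.sum_congr rfl fun i _ => h2 i

/-- the leading form does not vanish identically. -/
lemma exists_leadForm_ne {n : ℕ} (p : MvPolynomial (Fin n) ℂ) (hp : p ≠ 0) :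
    ∃ v : EuclideanSpace ℂ (Fin n),
      evalAt v (MvPolynomial.homogeneousComponent p.totalDegree p) ≠ 0 := by
  by_contra hcon
  push Not at hcon
  have h0 : MvPolynomial.homogeneousComponent p.totalDegree p = 0 := by
    apply MvPolynomial.funext
    intro x
    have := hcon (WithLp.toLp 2 x)
    simpa [evalAt] using this
  obtain ⟨m, hm, hmd⟩ := Finset.exists_mem_eq_sup p.support
    (MvPolynomial.support_nonempty.2 hp) (fun m => m.sum fun _ e => e)
  have h1 := congrArg (MvPolynomial.coeff m) h0
  rw [MvPolynomial.coeff_homogeneousComponent] at h1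
  have : m.degree = p.totalDegree := by
    rw [MvPolynomial.totalDegree, hmd]; rfl
  rw [if_pos this] at h1
  exact (MvPolynomial.mem_support_iff.1 hm) (by simpa using h1)

lemma evalAt_scaled_tendsto {n : ℕ} (p : MvPolynomial (Fin n) ℂ) {ι : Type*} {l : Filter ι}
    (s : ι → ℝ) (hs : Tendsto s l atTop) (u : ι → EuclideanSpace ℂ (Fin n))
    (v : EuclideanSpace ℂ (Fin n)) (hu : Tendsto u l (nhds v)) :
    Tendsto (fun i => evalAt ((s i : ℂ) • u i) p / (s i : ℂ) ^ p.totalDegree) l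
      (nhds (evalAt v (MvPolynomial.homogeneousComponent p.totalDegree p))) := by
  have hlim : Tendsto (fun i => ∑ k ∈ Finset.range (p.totalDegree + 1),
      ((s i : ℂ)⁻¹) ^ (p.totalDegree - k) * evalAt (u i) (MvPolynomial.homogeneousComponent k p)) l
      (nhds (∑ k ∈ Finset.range (p.totalDegree + 1),
        (0 : ℂ) ^ (p.totalDegree - k) * evalAt v (MvPolynomial.homogeneousComponent k p))) := by
    apply tendsto_finsetSum
    intro k _
    apply Filter.Tendsto.mul
    · apply Filter.Tendsto.pow
      have : Tendsto (fun i => (((s i)⁻¹ : ℝ) : ℂ)) l (nhds ((0 : ℝ) : ℂ)) :=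
        (Complex.continuous_ofReal.tendsto 0).comp (tendsto_inv_atTop_zero.comp hs)
      simpa using this
    · exact ((evalAt_continuous _).tendsto v).comp hu
  have he : ∑ k ∈ Finset.range (p.totalDegree + 1),
        (0 : ℂ) ^ (p.totalDegree - k) * evalAt v (MvPolynomial.homogeneousComponent k p)
      = evalAt v (MvPolynomial.homogeneousComponent p.totalDegree p) := by
    rw [Finset.sum_range_succ, Finset.sum_eq_zero]
    · simp
    · intro k hk
      have := Finset.mem_range.1 hk
      rw [zero_pow (by omega), zero_mul]
  rw [he] at hlim
  refine hlim.congr' ?_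
  filter_upwards [hs.eventually_gt_atTop 0] with i hi
  have hne : (s i : ℂ) ≠ 0 := by exact_mod_cast hi.ne'
  rw [evalAt_smul, Finset.sum_div]
  refine Finset.sum_congr rfl fun k hk => ?_
  have hk' : k ≤ p.totalDegree := by have := Finset.mem_range.1 hk; omega
  have : (s i : ℂ) ^ p.totalDegree = (s i : ℂ) ^ (p.totalDegree - k) * (s i : ℂ) ^ k := by
    rw [← pow_add]; congr 1; omega
  rw [this, inv_pow]
  field_simp

lemma totalDegree_le_of_growth {n : ℕ} (p : MvPolynomial (Fin n) ℂ) (C ρ : ℝ) (hρ : 0 ≤ ρ)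
    (h : ∀ w : EuclideanSpace ℂ (Fin n), ‖evalAt w p‖ ≤ C * (1 + ‖w‖) ^ ρ) :
    (p.totalDegree : ℝ) ≤ ρ := by
  by_contra hcon
  push Not at hcon
  have hp : p ≠ 0 := by
    rintro rfl
    simp at hcon; linarith
  obtain ⟨v, hv⟩ := exists_leadForm_ne p hp
  apply hv
  have ht := evalAt_scaled_tendsto p (fun s : ℝ => s) tendsto_id (fun _ => v) v tendsto_const_nhds
  refine tendsto_nhds_unique ht ?_
  have hb : Tendsto (fun s : ℝ => |C| * (1 + ‖v‖) ^ ρ * s ^ (-(p.totalDegree - ρ))) atTop (nhds 0) := by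
    have := (tendsto_rpow_neg_atTop (y := p.totalDegree - ρ) (by linarith)).const_mul
      (|C| * (1 + ‖v‖) ^ ρ)
    simpa using this
  apply squeeze_zero_norm' _ hb
  filter_upwards [eventually_ge_atTop 1] with s hs
  rw [norm_div, norm_pow, Complex.norm_real, Real.norm_of_nonneg (by linarith)]
  rw [div_le_iff₀ (by positivity)]
  have h1 := h ((s : ℂ) • v)
  have h2 : 1 + ‖(s : ℂ) • v‖ ≤ (1 + ‖v‖) * s := by
    rw [norm_smul, Complex.norm_real, Real.norm_of_nonneg (by linarith)]
    nlinarith [norm_nonneg v]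
  calc _ ≤ C * (1 + ‖(s : ℂ) • v‖) ^ ρ := h1
    _ ≤ |C| * (1 + ‖(s : ℂ) • v‖) ^ ρ := by gcongr; exact le_abs_self C
    _ ≤ |C| * ((1 + ‖v‖) * s) ^ ρ := by gcongr
    _ = |C| * (1 + ‖v‖) ^ ρ * s ^ ρ := by
        rw [Real.mul_rpow (by positivity) (by linarith)]; ring
    _ = _ := by
        rw [mul_assoc (_ * _), ← Real.rpow_natCast s, ← Real.rpow_add (by linarith)]
        congr 2; ring

lemma dense_ne_zero {n : ℕ} (p : MvPolynomial (Fin n) ℂ) (hp : p ≠ 0) :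
    Dense {w : EuclideanSpace ℂ (Fin n) | evalAt w p ≠ 0} := by
  by_contra hcon
  rw [dense_iff_inter_open] at hcon
  push Not at hcon
  obtain ⟨U, hU, ⟨w0, hw0⟩, hUe⟩ := hcon
  apply hp
  have han : AnalyticOnNhd ℂ (fun w : EuclideanSpace ℂ (Fin n) => evalAt w p) univ := by
    intro x _
    have := AnalyticAt.aeval_mvPolynomial (𝕜 := ℂ) (A := ℂ)
      (f := fun (w : EuclideanSpace ℂ (Fin n)) i => w i) (z := x)
      (fun i => ((EuclideanSpace.proj i : EuclideanSpace ℂ (Fin n) →L[ℂ] ℂ)).analyticAt x) p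
    exact this
  have hev : (fun w : EuclideanSpace ℂ (Fin n) => evalAt w p) =ᶠ[nhds w0] 0 := by
    filter_upwards [hU.mem_nhds hw0] with w hw
    by_contra hne
    have : w ∈ (∅ : Set (EuclideanSpace ℂ (Fin n))) := by rw [← hUe]; exact ⟨hw, hne⟩
    exact this
  have := han.eqOn_zero_of_preconnected_of_eventuallyEq_zero isPreconnected_univ (mem_univ w0) hev
  apply MvPolynomial.funext
  intro x
  have := this (mem_univ (WithLp.toLp 2 x))
  simpa [evalAt] using this


lemma pseudo_div {P : Type*} [CommRing P] [IsDomain P] (J : Ideal (Polynomial P))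
    (F : Polynomial P) (hF : F ∈ J) (hF0 : F ≠ 0)
    (hmin : ∀ p ∈ J, p ≠ 0 → F.natDegree ≤ p.natDegree) :
    ∀ p ∈ J, ∃ k : ℕ, ∃ Q, Polynomial.C (F.leadingCoeff ^ k) * p = F * Q := by
  have key : ∀ n : ℕ, ∀ p ∈ J, p.natDegree < n →
      ∃ k : ℕ, ∃ Q, Polynomial.C (F.leadingCoeff ^ k) * p = F * Q := by
    intro n
    induction n with
    | zero => intro p _ h; omega
    | succ n ih =>
      intro p hp hn
      by_cases hp0 : p = 0
      · exact ⟨0, 0, by simp [hp0]⟩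
      have hle := hmin p hp hp0
      set p' := Polynomial.C F.leadingCoeff * p
        - Polynomial.C p.leadingCoeff * Polynomial.X ^ (p.natDegree - F.natDegree) * F with hp'
      have hp'J : p' ∈ J := J.sub_mem (J.mul_mem_left _ hp) (J.mul_mem_left _ hF)
      have hlc : F.leadingCoeff ≠ 0 := Polynomial.leadingCoeff_ne_zero.2 hF0
      have hlcp : p.leadingCoeff ≠ 0 := Polynomial.leadingCoeff_ne_zero.2 hp0
      have hd : p' = 0 ∨ p'.natDegree < p.natDegree := by
        by_cases h0 : p' = 0
        · exact Or.inl h0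
        right
        have h1 : p'.natDegree ≤ p.natDegree := by
          refine (Polynomial.natDegree_sub_le _ _).trans (max_le ?_ ?_)
          · exact Polynomial.natDegree_C_mul_le _ _
          · rw [mul_assoc]
            refine (Polynomial.natDegree_C_mul_le _ _).trans ?_
            refine Polynomial.natDegree_mul_le.trans ?_
            rw [Polynomial.natDegree_X_pow]; omega
        rcases h1.lt_or_eq with h | h
        · exact h
        exfalso
        apply Polynomial.leadingCoeff_ne_zero.2 h0
        rw [Polynomial.leadingCoeff, h, hp', Polynomial.coeff_sub, Polynomial.coeff_C_mul, mul_assoc,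
          Polynomial.coeff_C_mul, Polynomial.coeff_X_pow_mul', if_pos (by omega)]
        have : p.natDegree - (p.natDegree - F.natDegree) = F.natDegree := by omega
        rw [this]
        simp only [Polynomial.coeff_natDegree]; ring
      have hex : ∃ k : ℕ, ∃ Q, Polynomial.C (F.leadingCoeff ^ k) * p' = F * Q := by
        rcases hd with h | h
        · exact ⟨0, 0, by simp [h]⟩
        · exact ih p' hp'J (by omega)
      obtain ⟨k, Q, hQ⟩ := hex
      refine ⟨k + 1, Q + Polynomial.C (F.leadingCoeff ^ k) * (Polynomial.C p.leadingCoeff *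
        Polynomial.X ^ (p.natDegree - F.natDegree)), ?_⟩
      rw [mul_add, ← hQ, hp', pow_succ, Polynomial.C_mul]
      ring
  intro p hp
  exact key _ p hp (Nat.lt_succ_self _)

lemma exists_min_natDegree {P : Type*} [CommRing P] (J : Ideal (Polynomial P))
    (hJ : J ≠ ⊥) : ∃ F ∈ J, F ≠ 0 ∧ ∀ p ∈ J, p ≠ 0 → F.natDegree ≤ p.natDegree := by
  classical
  have hex : ∃ n : ℕ, ∃ F ∈ J, F ≠ 0 ∧ F.natDegree = n := by
    obtain ⟨F, hF, h0⟩ := Submodule.exists_mem_ne_zero_of_ne_bot hJ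
    exact ⟨_, F, hF, h0, rfl⟩
  obtain ⟨F, hF, h0, hn⟩ := Nat.find_spec hex
  exact ⟨F, hF, h0, fun p hp hp0 => hn ▸ Nat.find_min' hex ⟨p, hp, hp0, rfl⟩⟩

/-- Bezout relation. -/
lemma bezout_const {P R : Type*} [CommRing P] [IsDomain P] [CommRing R] [IsDomain R]
    (ψ : Polynomial P →+* R) (hinj : ∀ e : P, ψ (Polynomial.C e) = 0 → e = 0)
    (F : Polynomial P) (hF : ψ F = 0) (hF0 : F ≠ 0)
    (hmin : ∀ p, ψ p = 0 → p ≠ 0 → F.natDegree ≤ p.natDegree)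
    (D : Polynomial P) (hD : ψ D ≠ 0) :
    ∃ E : P, E ≠ 0 ∧ ∃ U V, U * D + V * F = Polynomial.C E := by
  set J : Ideal (Polynomial P) := Ideal.span {D, F} with hJ
  have hFJ : F ∈ J := Ideal.subset_span (by simp)
  have hDJ : D ∈ J := Ideal.subset_span (by simp)
  have hJb : J ≠ ⊥ := fun h => hF0 (by rw [h] at hFJ; simpa using hFJ)
  obtain ⟨G0, hG, hG0, hGmin⟩ := exists_min_natDegree J hJb
  have hpd := pseudo_div J G0 hG hG0 hGmin
  have hlc : ∀ k : ℕ, ψ (Polynomial.C (G0.leadingCoeff ^ k)) ≠ 0 := fun k h =>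
    pow_ne_zero k (Polynomial.leadingCoeff_ne_zero.2 hG0) (hinj _ h)
  have hψG : ψ G0 ≠ 0 := by
    intro h
    obtain ⟨k, Q, hQ⟩ := hpd D hDJ
    have := congrArg ψ hQ
    rw [map_mul, map_mul, h, zero_mul] at this
    rcases mul_eq_zero.1 this with h1 | h1
    · exact hlc k h1
    · exact hD h1
  obtain ⟨k, Q, hQ⟩ := hpd F hFJ
  have hk : Polynomial.C (G0.leadingCoeff ^ k) ≠ 0 := by
    simp [hG0]
  have hψQ : ψ Q = 0 := by
    have := congrArg ψ hQ
    rw [map_mul, map_mul, hF, mul_zero] at this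
    exact (mul_eq_zero.1 this.symm).resolve_left hψG
  have hQ0 : Q ≠ 0 := by
    rintro rfl
    rw [mul_zero] at hQ
    exact (mul_ne_zero hk hF0) hQ
  have hdeg := congrArg Polynomial.natDegree hQ
  rw [Polynomial.natDegree_mul hk hF0, Polynomial.natDegree_mul hG0 hQ0,
    Polynomial.natDegree_C] at hdeg
  have h1 := hmin Q hψQ hQ0
  have h0 : G0.natDegree = 0 := by omega
  rw [Polynomial.eq_C_of_natDegree_eq_zero h0] at hG hG0
  refine ⟨G0.coeff 0, fun h => hG0 (by rw [h]; simp), ?_⟩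
  obtain ⟨U, V, hUV⟩ := Ideal.mem_span_pair.1 hG
  exact ⟨U, V, hUV⟩

/-- all coefficients divisible by a prime factor of the leading coefficient. -/
lemma unit_of_zeros {r : ℕ} (F : Polynomial (MvPolynomial (Fin r) ℂ)) (hF0 : F ≠ 0)
    (hprim : F.IsPrimitive)
    (hz : ∀ w : Fin r → ℂ, MvPolynomial.eval w F.leadingCoeff = 0 →
      ∀ i, MvPolynomial.eval w (F.coeff i) = 0) : IsUnit F.leadingCoeff := by
  by_contra hu
  obtain ⟨π, hπ, hπd⟩ := WfDvdMonoid.exists_irreducible_factor hu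
    (Polynomial.leadingCoeff_ne_zero.2 hF0)
  have hpr : Prime π := hπ.prime
  have hP : (Ideal.span {π}).IsPrime := (Ideal.span_singleton_prime hpr.ne_zero).2 hpr
  have hdvd : Polynomial.C π ∣ F := by
    rw [Polynomial.C_dvd_iff_dvd_coeff]
    intro i
    rw [← Ideal.mem_span_singleton, ← MvPolynomial.IsPrime.vanishingIdeal_zeroLocus (K := ℂ)
      (Ideal.span {π})]
    rw [MvPolynomial.mem_vanishingIdeal_iff]
    intro x hx
    have hx' : MvPolynomial.eval x π = 0 := by
      have := (MvPolynomial.mem_zeroLocus_iff.1 hx) π (Ideal.mem_span_singleton_self π)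
      simpa using this
    have := hz x (by obtain ⟨c, hc⟩ := hπd; rw [hc, map_mul, hx', zero_mul]) i
    simpa using this
  exact hπ.not_isUnit (hprim π hdvd)


/-- the polynomial map with components `G`. -/
noncomputable def gmap {n r : ℕ} (G : Fin r → MvPolynomial (Fin n) ℂ)
    (z : EuclideanSpace ℂ (Fin n)) : EuclideanSpace ℂ (Fin r) :=
  WithLp.toLp 2 (fun i => evalAt z (G i))

lemma gmap_continuous {n r : ℕ} (G : Fin r → MvPolynomial (Fin n) ℂ) : Continuous (gmap G) := by
  unfold gmap
  have : Continuous (fun z : EuclideanSpace ℂ (Fin n) => (fun i => evalAt z (G i))) :=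
    continuous_pi fun i => evalAt_continuous (G i)
  exact (PiLp.continuous_toLp 2 _).comp this

lemma mem_vanishIdeal {n : ℕ} (A : Set (EuclideanSpace ℂ (Fin n))) (p : MvPolynomial (Fin n) ℂ) :
    p ∈ vanishIdeal A ↔ ∀ z ∈ A, evalAt z p = 0 := by
  unfold vanishIdeal
  rw [RingHom.mem_ker]
  constructor
  · intro h z hz
    exact congrFun h ⟨z, hz⟩
  · intro h
    funext z
    exact h z.1 z.2

lemma IsAlgebraicSet.mem_of {n : ℕ} {A : Set (EuclideanSpace ℂ (Fin n))} (halg : IsAlgebraicSet A)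
    (z : EuclideanSpace ℂ (Fin n)) (h : ∀ p ∈ vanishIdeal A, evalAt z p = 0) : z ∈ A := by
  obtain ⟨S, rfl⟩ := halg
  intro p hp
  exact h p ((mem_vanishIdeal _ _).2 fun z hz => hz p hp)

lemma IsAlgebraicSet.isClosed {n : ℕ} {A : Set (EuclideanSpace ℂ (Fin n))}
    (halg : IsAlgebraicSet A) : IsClosed A := by
  obtain ⟨S, rfl⟩ := halg
  have : {z : EuclideanSpace ℂ (Fin n) | ∀ p ∈ S, evalAt z p = 0}
      = ⋂ p ∈ S, {z | evalAt z p = 0} := by ext; simp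
  rw [this]
  exact isClosed_biInter fun p _ => isClosed_eq (evalAt_continuous p) continuous_const

/-- value of `F(w, t)`. -/
noncomputable def ev {r : ℕ} (w : EuclideanSpace ℂ (Fin r)) (t : ℂ)
    (F : Polynomial (MvPolynomial (Fin r) ℂ)) : ℂ := evHom (fun i => w i) t F

lemma evalAt_substHom {n r : ℕ} (G : Fin r → MvPolynomial (Fin n) ℂ)
    (h : MvPolynomial (Fin n) ℂ) (z : EuclideanSpace ℂ (Fin n))
    (p : Polynomial (MvPolynomial (Fin r) ℂ)) :
    evalAt z (substHom G h p) = ev (gmap G z) (evalAt z h) p :=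
  eval_substHom G h _ p

lemma bounded_on {n : ℕ} (h : MvPolynomial (Fin n) ℂ) (B : ℝ) :
    ∃ B' : ℝ, 0 ≤ B' ∧ ∀ z : EuclideanSpace ℂ (Fin n), ‖z‖ ≤ B → ‖evalAt z h‖ ≤ B' := by
  obtain ⟨C, hC, hb⟩ := evalAt_growth h
  refine ⟨C * (1 + |B|) ^ h.totalDegree, by positivity, fun z hz => (hb z).trans ?_⟩
  gcongr
  exact hz.trans (le_abs_self B)

/-- the generic version of the minimal equation. -/
lemma generic_eq {n r : ℕ} {A : Set (EuclideanSpace ℂ (Fin n))} (halg : IsAlgebraicSet A)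
    (hprime : (vanishIdeal A).IsPrime) (G : Fin r → MvPolynomial (Fin n) ℂ)
    (hinj : ∀ P : MvPolynomial (Fin r) ℂ, (∀ z ∈ A, evalAt (gmap G z) P = 0) → P = 0)
    (hprop : ∀ R : ℝ, ∃ B : ℝ, ∀ z ∈ A, ‖gmap G z‖ ≤ R → ‖z‖ ≤ B)
    (h : MvPolynomial (Fin n) ℂ) :
    ∃ F : Polynomial (MvPolynomial (Fin r) ℂ), F.IsPrimitive ∧ F ≠ 0 ∧
      (∀ z ∈ A, ev (gmap G z) (evalAt z h) F = 0) ∧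
      (∃ E : MvPolynomial (Fin r) ℂ, E ≠ 0 ∧ ∀ w t, evalAt w E ≠ 0 → ev w t F = 0 →
        ∃ z ∈ A, gmap G z = w ∧ evalAt z h = t) ∧
      (∀ F' : Polynomial (MvPolynomial (Fin r) ℂ), F' ≠ 0 →
        (∀ z ∈ A, ev (gmap G z) (evalAt z h) F' = 0) → F.natDegree ≤ F'.natDegree) := by
  set I := vanishIdeal A with hI
  have hmemI : ∀ p, substHom G h p ∈ I ↔ ∀ z ∈ A, ev (gmap G z) (evalAt z h) p = 0 := by
    intro p
    rw [hI, mem_vanishIdeal]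
    simp only [evalAt_substHom]
  obtain ⟨D, hD, hlift⟩ := generic_lift I hprime G h
  have hlift' : ∀ (w : EuclideanSpace ℂ (Fin r)) (t : ℂ),
      (∀ p, substHom G h p ∈ I → ev w t p = 0) → ev w t D ≠ 0 →
        ∃ z ∈ A, gmap G z = w ∧ evalAt z h = t := by
    intro w t h1 h2
    obtain ⟨x, hx1, hx2, hx3⟩ := hlift (fun i => w i) t h1 h2
    refine ⟨WithLp.toLp 2 x, halg.mem_of _ hx1, ?_, hx3⟩
    ext i
    exact hx2 i
  set ψ : Polynomial (MvPolynomial (Fin r) ℂ) →+* (MvPolynomial (Fin n) ℂ ⧸ I) :=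
    (Ideal.Quotient.mk I).comp (substHom G h) with hψ
  have hψ0 : ∀ p, ψ p = 0 ↔ substHom G h p ∈ I := fun p => by
    simp [hψ, Ideal.Quotient.eq_zero_iff_mem]
  have hψC : ∀ e, ψ (Polynomial.C e) = 0 → e = 0 := by
    intro e he
    apply hinj
    have := (hmemI _).1 ((hψ0 _).1 he)
    intro z hz
    simpa [ev, evHom, evalAt] using this z hz
  -- algebraicity
  have hker : RingHom.ker ψ ≠ ⊥ := by
    intro hbot
    have hD0 : D ≠ 0 := by rintro rfl; simp at hD
    obtain ⟨w, hw⟩ : ∃ w : EuclideanSpace ℂ (Fin r), evalAt w D.leadingCoeff ≠ 0 :=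
      (dense_ne_zero _ (Polynomial.leadingCoeff_ne_zero.2 hD0)).nonempty
    set Dw := D.map (MvPolynomial.eval (fun i => w i)) with hDw
    have hDw0 : Dw ≠ 0 := by
      intro h0
      apply hw
      have := congrArg (fun p => Polynomial.coeff p D.natDegree) h0
      simpa [hDw, evalAt] using this
    obtain ⟨B, hB⟩ := hprop ‖w‖
    obtain ⟨B', hB'0, hB'⟩ := bounded_on h B
    have hinfi : ({t : ℂ | B' < ‖t‖} \ (Dw.roots.toFinset : Set ℂ)).Nonempty := by
      apply Set.Infinite.nonempty
      apply Set.Infinite.sdiff _ (Finset.finite_toSet _)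
      intro hfin
      have hb := hfin.isBounded
      obtain ⟨c, hc⟩ := hb.exists_norm_le
      have h1 : ((max B' c + 1 : ℝ) : ℂ) ∈ {t : ℂ | B' < ‖t‖} := by
        simp only [Set.mem_ofPred_eq, Complex.norm_real]
        exact lt_of_lt_of_le (by linarith [le_max_left B' c]) (le_abs_self _)
      have h2 := hc _ h1
      rw [Complex.norm_real] at h2
      have := (le_abs_self _).trans h2
      linarith [le_max_right B' c]
    obtain ⟨t, ht1, ht2⟩ := hinfi
    obtain ⟨z, hz, hz1, hz2⟩ := hlift' w t (fun p hp => by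
        have : p ∈ RingHom.ker ψ := (hψ0 p).2 hp
        rw [hbot] at this
        have hp0 : p = 0 := by simpa using this
        rw [hp0]; simp [ev]) (by
        intro h0
        apply ht2
        have : Dw.eval t = 0 := by rw [← h0, ev, evHom_eq]
        simp [hDw0, Polynomial.IsRoot, this])
    have := hB' z (hB z hz (by rw [hz1]))
    rw [hz2] at this
    have ht1' : B' < ‖t‖ := ht1
    linarith
  obtain ⟨F0, hF0k, hF00, hF0min⟩ := exists_min_natDegree _ hker
  let : NormalizedGCDMonoid (MvPolynomial (Fin r) ℂ) :=
    Classical.choice inferInstance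
  set F := F0.primPart with hF
  have hFne : F ≠ 0 := Polynomial.primPart_ne_zero F0
  have hFdeg : F.natDegree = F0.natDegree := Polynomial.natDegree_primPart F0
  have hψF : ψ F = 0 := by
    have h1 : ψ F0 = 0 := hF0k
    rw [Polynomial.eq_C_content_mul_primPart F0, map_mul] at h1
    rcases mul_eq_zero.1 h1 with h2 | h2
    · exact absurd (hψC _ h2) (fun hc => hF00 (Polynomial.content_eq_zero_iff.1 hc))
    · exact h2
  have hmin : ∀ p, ψ p = 0 → p ≠ 0 → F.natDegree ≤ p.natDegree := fun p hp hp0 => by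
    rw [hFdeg]; exact hF0min p hp hp0
  obtain ⟨E, hE0, U, V, hUV⟩ := bezout_const ψ hψC F hψF hFne hmin D
    (fun hh => hD ((hψ0 D).1 hh))
  have hpd := pseudo_div (RingHom.ker ψ) F hψF hFne hmin
  refine ⟨F, F0.isPrimitive_primPart, hFne, (hmemI F).1 ((hψ0 F).1 hψF), ?_, ?_⟩
  · refine ⟨E * F.leadingCoeff, mul_ne_zero hE0 (Polynomial.leadingCoeff_ne_zero.2 hFne), ?_⟩
    intro w t hw hFt
    have hw' : evalAt w E ≠ 0 ∧ evalAt w F.leadingCoeff ≠ 0 := by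
      rw [evalAt, map_mul] at hw
      exact mul_ne_zero_iff.1 hw
    have hevC : ∀ e, ev w t (Polynomial.C e) = evalAt w e := fun e => by simp [ev, evHom, evalAt]
    apply hlift'
    · intro p hp
      obtain ⟨k, Q, hQ⟩ := hpd p ((hψ0 p).2 hp)
      have := congrArg (ev w t) hQ
      have h2 : ev w t (Polynomial.C (F.leadingCoeff ^ k)) * ev w t p = ev w t F * ev w t Q := by
        simpa [ev] using this
      rw [hFt, zero_mul, hevC] at h2
      refine (mul_eq_zero.1 h2).resolve_left ?_
      rw [evalAt, map_pow]
      exact pow_ne_zero _ hw'.2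
    · intro h0
      have := congrArg (ev w t) hUV
      rw [hevC] at this
      apply hw'.1
      rw [← this]
      simp only [ev, map_add, map_mul] at h0 hFt ⊢
      rw [h0, hFt]; ring
  · intro F' hF' hF'A
    exact hmin F' ((hψ0 _).2 ((hmemI _).2 hF'A)) hF'


lemma ev_eq {r : ℕ} (w : EuclideanSpace ℂ (Fin r)) (t : ℂ)
    (F : Polynomial (MvPolynomial (Fin r) ℂ)) :
    ev w t F = (F.map (MvPolynomial.eval (fun i => w i))).eval t := evHom_eq _ _ _

lemma ev_continuous {r : ℕ} (t : ℂ) (F : Polynomial (MvPolynomial (Fin r) ℂ)) :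
    Continuous (fun w => ev w t F) := by
  have : (fun w : EuclideanSpace ℂ (Fin r) => ev w t F)
      = fun w => ∑ i ∈ F.support, evalAt w (F.coeff i) * t ^ i := by
    funext w
    simp [ev, evHom, Polynomial.eval₂_def, Polynomial.sum, evalAt]
  rw [this]
  exact continuous_finsetSum _ fun i _ => (evalAt_continuous _).mul continuous_const

lemma coeff_bound_of_roots (p : Polynomial ℂ) (hp : p ≠ 0) (B : ℝ)
    (h : ∀ t, p.eval t = 0 → ‖t‖ ≤ B) (i : ℕ) :
    ‖p.coeff i‖ ≤ ‖p.leadingCoeff‖ * (B ^ (p.natDegree - i) * p.natDegree.choose i) := by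
  have hl : p.leadingCoeff ≠ 0 := Polynomial.leadingCoeff_ne_zero.2 hp
  set q := p * Polynomial.C p.leadingCoeff⁻¹ with hq
  have hqm : q.Monic := Polynomial.monic_mul_leadingCoeff_inv hp
  have hqd : q.natDegree = p.natDegree := by
    rw [hq, Polynomial.natDegree_mul_C (inv_ne_zero hl)]
  have := Polynomial.coeff_le_of_roots_le (p := q) (f := RingHom.id ℂ) (B := B) i hqm
    (IsAlgClosed.splits _) (by
      intro z hz
      rw [Polynomial.map_id] at hz
      have h1 := (Polynomial.mem_roots'.1 hz).2
      apply h
      rw [Polynomial.IsRoot, hq, Polynomial.eval_mul, Polynomial.eval_C] at h1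
      exact (mul_eq_zero.1 h1).resolve_right (inv_ne_zero hl))
  rw [Polynomial.map_id, hqd] at this
  have h2 : p.coeff i = p.leadingCoeff * q.coeff i := by
    rw [hq, Polynomial.coeff_mul_C]; field_simp
  rw [h2, norm_mul]
  gcongr

lemma monic_eq {n r : ℕ} {A : Set (EuclideanSpace ℂ (Fin n))} (halg : IsAlgebraicSet A)
    (hprime : (vanishIdeal A).IsPrime) (G : Fin r → MvPolynomial (Fin n) ℂ)
    (hinj : ∀ P : MvPolynomial (Fin r) ℂ, (∀ z ∈ A, evalAt (gmap G z) P = 0) → P = 0)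
    (hprop : ∀ R : ℝ, ∃ B : ℝ, ∀ z ∈ A, ‖gmap G z‖ ≤ R → ‖z‖ ≤ B)
    (h : MvPolynomial (Fin n) ℂ) :
    ∃ F : Polynomial (MvPolynomial (Fin r) ℂ), F.Monic ∧
      (∀ z ∈ A, ev (gmap G z) (evalAt z h) F = 0) ∧
      (∀ w t, ev w t F = 0 → ∃ z ∈ A, gmap G z = w ∧ evalAt z h = t) ∧
      (∀ F' : Polynomial (MvPolynomial (Fin r) ℂ), F' ≠ 0 →
        (∀ z ∈ A, ev (gmap G z) (evalAt z h) F' = 0) → F.natDegree ≤ F'.natDegree) := by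
  obtain ⟨F, hprim, hF0, hFA, ⟨E, hE0, hE⟩, hmin⟩ := generic_eq halg hprime G hinj hprop h
  have hlc0 := Polynomial.leadingCoeff_ne_zero.2 hF0
  have hunit : IsUnit F.leadingCoeff := by
    apply unit_of_zeros F hF0 hprim
    intro w0 hw0 i
    set W0 : EuclideanSpace ℂ (Fin r) := WithLp.toLp 2 w0 with hW0
    change evalAt W0 (F.coeff i) = 0
    have hw0' : evalAt W0 F.leadingCoeff = 0 := hw0
    obtain ⟨B, hB⟩ := hprop (‖W0‖ + 1)
    obtain ⟨B', hB'0, hB'⟩ := bounded_on h B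
    have hdense := dense_ne_zero (E * F.leadingCoeff) (mul_ne_zero hE0 hlc0)
    set S := {w : EuclideanSpace ℂ (Fin r) | evalAt w (E * F.leadingCoeff) ≠ 0} with hS
    have hne : (nhdsWithin W0 S).NeBot := mem_closure_iff_nhdsWithin_neBot.1 (hdense W0)
    have hball : ∀ᶠ w in nhdsWithin W0 S, ‖w‖ ≤ ‖W0‖ + 1 := by
      apply mem_nhdsWithin_of_mem_nhds
      have : ball W0 1 ∈ nhds W0 := ball_mem_nhds W0 one_pos
      filter_upwards [this] with w hw
      rw [mem_ball, dist_eq_norm] at hw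
      have := norm_le_norm_add_norm_sub' w W0
      linarith
    have hle : ∀ᶠ w in nhdsWithin W0 S, ‖evalAt w (F.coeff i)‖ ≤
        ‖evalAt w F.leadingCoeff‖ * (B' ^ (F.natDegree - i) * F.natDegree.choose i) := by
      filter_upwards [hball, self_mem_nhdsWithin] with w hw hwS
      have hwS' : evalAt w E ≠ 0 ∧ evalAt w F.leadingCoeff ≠ 0 := by
        have : evalAt w (E * F.leadingCoeff) ≠ 0 := hwS
        rw [evalAt, map_mul] at this
        exact mul_ne_zero_iff.1 this
      set p := F.map (MvPolynomial.eval (fun i => w i)) with hp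
      have hlcp : MvPolynomial.eval (fun i => w i) F.leadingCoeff ≠ 0 := hwS'.2
      have hd : p.natDegree = F.natDegree := Polynomial.natDegree_map_of_leadingCoeff_ne_zero _ hlcp
      have hpl : p.leadingCoeff = evalAt w F.leadingCoeff := by
        rw [Polynomial.leadingCoeff, hd, hp, Polynomial.coeff_map]; rfl
      have hp0 : p ≠ 0 := by
        rw [← Polynomial.leadingCoeff_ne_zero, hpl]; exact hwS'.2
      have := coeff_bound_of_roots p hp0 B' (by
        intro t ht
        obtain ⟨z, hz, hz1, hz2⟩ := hE w t hwS'.1 (by rw [ev_eq]; exact ht)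
        rw [← hz2]
        exact hB' z (hB z hz (by rw [hz1]; exact hw))) i
      rw [hpl, hd, hp, Polynomial.coeff_map] at this
      exact this
    have hc1 : Tendsto (fun w => ‖evalAt w (F.coeff i)‖) (nhdsWithin W0 S)
        (nhds ‖evalAt W0 (F.coeff i)‖) :=
      ((evalAt_continuous _).norm.tendsto W0).mono_left nhdsWithin_le_nhds
    have hc2 : Tendsto (fun w => ‖evalAt w F.leadingCoeff‖ *
        (B' ^ (F.natDegree - i) * F.natDegree.choose i)) (nhdsWithin W0 S)
        (nhds (‖evalAt W0 F.leadingCoeff‖ * (B' ^ (F.natDegree - i) * F.natDegree.choose i))) :=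
      (((evalAt_continuous _).norm.mul continuous_const).tendsto W0).mono_left nhdsWithin_le_nhds
    have := le_of_tendsto_of_tendsto hc1 hc2 hle
    rw [hw0', norm_zero, zero_mul] at this
    exact norm_le_zero_iff.1 this
  obtain ⟨a, ha⟩ := hunit
  set F1 := Polynomial.C (↑a⁻¹ : MvPolynomial (Fin r) ℂ) * F with hF1
  have hF1m : F1.Monic := by
    rw [Polynomial.Monic, hF1, Polynomial.leadingCoeff_mul, Polynomial.leadingCoeff_C, ← ha]
    exact a.inv_mul
  have hau : ∀ w t, ev w t (Polynomial.C (↑a⁻¹ : MvPolynomial (Fin r) ℂ)) ≠ 0 := by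
    intro w t h0
    have h1 : Polynomial.C (↑a⁻¹ : MvPolynomial (Fin r) ℂ) * Polynomial.C (a : MvPolynomial (Fin r) ℂ) = 1 := by
      rw [← Polynomial.C_mul, a.inv_mul, Polynomial.C_1]
    have := congrArg (evHom (fun i => w i) t) h1
    rw [map_mul, map_one] at this
    unfold ev at h0
    rw [h0, zero_mul] at this
    exact zero_ne_one this
  have hevF1 : ∀ w t, ev w t F1 = 0 ↔ ev w t F = 0 := by
    intro w t
    have : ev w t F1 = ev w t (Polynomial.C (↑a⁻¹ : MvPolynomial (Fin r) ℂ)) * ev w t F := by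
      simp [ev, hF1]
    rw [this, mul_eq_zero]
    exact ⟨fun hh => hh.resolve_left (hau w t), Or.inr⟩
  have hF1d : F1.natDegree = F.natDegree := by
    rw [hF1, Polynomial.natDegree_C_mul (by exact a⁻¹.ne_zero)]
  refine ⟨F1, hF1m, fun z hz => (hevF1 _ _).2 (hFA z hz), ?_, by rw [hF1d]; exact hmin⟩
  intro w t hwt
  obtain ⟨B, hB⟩ := hprop (‖w‖ + 1)
  set Z := A ∩ closedBall 0 B with hZ
  have hZc : IsCompact Z := (isCompact_closedBall 0 B).inter_left halg.isClosed
  have him : IsClosed ((fun z => (gmap G z, evalAt z h)) '' Z) :=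
    (hZc.image ((gmap_continuous G).prodMk (evalAt_continuous h))).isClosed
  have hmem : (w, t) ∈ closure ((fun z => (gmap G z, evalAt z h)) '' Z) := by
    rw [Metric.mem_closure_iff]
    intro ε hε
    have hdense := dense_ne_zero E hE0
    have hm : 0 < F1.natDegree := by
      rcases Nat.eq_zero_or_pos F1.natDegree with h0 | h0
      · exfalso
        rw [Polynomial.eq_one_of_monic_natDegree_zero hF1m h0] at hwt
        simp [ev] at hwt
      · exact h0
    have hopen : ∃ w' : EuclideanSpace ℂ (Fin r), evalAt w' E ≠ 0 ∧ dist w w' < ε ∧ ‖w'‖ ≤ ‖w‖ + 1 ∧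
        ‖ev w' t F1‖ < ε ^ F1.natDegree := by
      have hU : {w' | dist w w' < min ε 1 ∧ ‖ev w' t F1‖ < ε ^ F1.natDegree} ∈ nhds w := by
        have h1 : ∀ᶠ w' in nhds w, ‖ev w' t F1‖ < ε ^ F1.natDegree := by
          apply (ev_continuous t F1).norm.continuousAt.eventually_lt continuousAt_const
          rw [hwt, norm_zero]; positivity
        filter_upwards [h1, ball_mem_nhds w (show 0 < min ε 1 by positivity)] with a ha1 ha2
        refine ⟨?_, ha1⟩
        rw [dist_comm]; exact ha2
      obtain ⟨w', hw'1, hw'2⟩ := (mem_closure_iff_nhds.1 (hdense w)) _ hU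
      refine ⟨w', hw'2, lt_of_lt_of_le hw'1.1 (min_le_left _ _), ?_, hw'1.2⟩
      have h1 : dist w w' < 1 := lt_of_lt_of_le hw'1.1 (min_le_right _ _)
      rw [dist_comm, dist_eq_norm] at h1
      have := norm_le_norm_add_norm_sub' w' w
      linarith
    obtain ⟨w', hw'E, hw'd, hw'b, hw'F⟩ := hopen
    set p := F1.map (MvPolynomial.eval (fun i => w' i)) with hp
    have hpm : p.Monic := hF1m.map _
    have hpd : p.natDegree = F1.natDegree := hF1m.natDegree_map _
    have hsp : p.Splits := IsAlgClosed.splits p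
    have hroot : ∃ t', p.eval t' = 0 ∧ ‖t - t'‖ < ε := by
      by_contra hcon
      push Not at hcon
      have hprod : p = (p.roots.map (fun a => Polynomial.X - Polynomial.C a)).prod :=
        hsp.eq_prod_roots_of_monic hpm
      have hcard : p.roots.card = F1.natDegree := by
        rw [← hpd]; exact hsp.natDegree_eq_card_roots.symm
      have hge : ∀ s : Multiset ℂ, (∀ a ∈ s, ε ≤ ‖t - a‖) →
          ε ^ s.card ≤ ‖((s.map (fun a => Polynomial.X - Polynomial.C a)).prod).eval t‖ := by
        intro s
        induction s using Multiset.induction_on with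
        | empty => simp
        | cons a s ih =>
          intro hs
          rw [Multiset.map_cons, Multiset.prod_cons, Polynomial.eval_mul, norm_mul,
            Multiset.card_cons, pow_succ, mul_comm]
          have h1 := hs a (Multiset.mem_cons_self a s)
          have h2 := ih fun b hb => hs b (Multiset.mem_cons_of_mem hb)
          simp only [Polynomial.eval_sub, Polynomial.eval_X, Polynomial.eval_C]
          gcongr
      have := hge p.roots (fun a ha => hcon a (Polynomial.mem_roots'.1 ha).2)
      rw [← hprod, hcard, hp, ← ev_eq] at this
      linarith
    obtain ⟨t', ht'1, ht'2⟩ := hroot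
    obtain ⟨z, hz, hz1, hz2⟩ := hE w' t' hw'E ((hevF1 _ _).1 (by rw [ev_eq]; exact ht'1))
    refine ⟨(w', t'), ⟨z, ⟨hz, ?_⟩, by rw [← hz1, ← hz2]⟩, ?_⟩
    · rw [mem_closedBall_zero_iff]
      exact hB z hz (by rw [hz1]; exact hw'b)
    · rw [Prod.dist_eq]
      exact max_lt hw'd (by simpa [dist_eq_norm] using ht'2)
  rw [him.closure_eq] at hmem
  obtain ⟨z, hz, hzz⟩ := hmem
  rw [Prod.mk.injEq] at hzz
  exact ⟨z, hz.1, hzz.1, hzz.2⟩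

/-- coefficient degree bound from growth. -/
lemma coeff_degree {n r : ℕ} {A : Set (EuclideanSpace ℂ (Fin n))}
    (G : Fin r → MvPolynomial (Fin n) ℂ) (h : MvPolynomial (Fin n) ℂ)
    (F : Polynomial (MvPolynomial (Fin r) ℂ)) (hF : F.Monic)
    (hatt : ∀ w t, ev w t F = 0 → ∃ z ∈ A, gmap G z = w ∧ evalAt z h = t)
    (ρ : ℝ) (hρ : 0 ≤ ρ)
    (hg : ∀ ε > 0, ∃ C : ℝ, ∀ z ∈ A, ‖evalAt z h‖ ≤ C * (1 + ‖gmap G z‖) ^ (ρ + ε)) (i : ℕ) :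
    ((F.coeff i).totalDegree : ℝ) ≤ (F.natDegree - i : ℕ) * ρ := by
  set k := F.natDegree - i with hk
  have key : ∀ ε > 0, ((F.coeff i).totalDegree : ℝ) ≤ k * (ρ + ε) := by
    intro ε hε
    obtain ⟨C, hC⟩ := hg ε hε
    apply totalDegree_le_of_growth _ (|C| ^ k * F.natDegree.choose i) _ (by positivity)
    intro w
    have := Polynomial.coeff_le_of_roots_le (p := F) (f := MvPolynomial.eval (fun i => w i))
      (B := |C| * (1 + ‖w‖) ^ (ρ + ε)) i hF (IsAlgClosed.splits _) (by
        intro t ht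
        obtain ⟨z, hz, hz1, hz2⟩ := hatt w t (by rw [ev_eq]; exact (Polynomial.mem_roots'.1 ht).2)
        rw [← hz2, ← hz1]
        refine (hC z hz).trans ?_
        gcongr
        exact le_abs_self C)
    rw [Polynomial.coeff_map] at this
    refine this.trans (le_of_eq ?_)
    rw [mul_pow, ← Real.rpow_natCast ((1 + ‖w‖) ^ (ρ + ε)), ← Real.rpow_mul (by positivity),
      mul_comm (ρ + ε)]
    ring
  have ht : Tendsto (fun ε : ℝ => (k : ℝ) * (ρ + ε)) (nhdsWithin 0 (Ioi 0)) (nhds (k * (ρ + 0))) :=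
    (Continuous.tendsto (by fun_prop) 0).mono_left nhdsWithin_le_nhds
  rw [add_zero] at ht
  exact ge_of_tendsto ht (by filter_upwards [self_mem_nhdsWithin] with ε hε using key ε hε)

lemma coeff_bound_on {n r : ℕ} {A : Set (EuclideanSpace ℂ (Fin n))}
    (G : Fin r → MvPolynomial (Fin n) ℂ) (h : MvPolynomial (Fin n) ℂ)
    (F : Polynomial (MvPolynomial (Fin r) ℂ)) (hF : F.Monic)
    (hatt : ∀ w t, ev w t F = 0 → ∃ z ∈ A, gmap G z = w ∧ evalAt z h = t)
    (w : EuclideanSpace ℂ (Fin r))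
    (hg : ∀ z ∈ A, gmap G z = w → ‖evalAt z h‖ ≤ 1) (i : ℕ) :
    ‖evalAt w (F.coeff i)‖ ≤ 2 ^ F.natDegree := by
  have := Polynomial.coeff_le_of_roots_le (p := F) (f := MvPolynomial.eval (fun i => w i))
    (B := 1) i hF (IsAlgClosed.splits _) (by
      intro t ht
      obtain ⟨z, hz, hz1, hz2⟩ := hatt w t (by rw [ev_eq]; exact (Polynomial.mem_roots'.1 ht).2)
      rw [← hz2]
      exact hg z hz hz1)
  rw [Polynomial.coeff_map, one_pow, one_mul] at this
  refine this.trans ?_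
  exact_mod_cast Nat.choose_le_two_pow _ _


lemma evalAt_hom_smul {n : ℕ} (p : MvPolynomial (Fin n) ℂ) (c : ℂ) (i : ℕ)
    (v : EuclideanSpace ℂ (Fin n)) :
    evalAt (c • v) (MvPolynomial.homogeneousComponent i p)
      = c ^ i * evalAt v (MvPolynomial.homogeneousComponent i p) := by
  have := (MvPolynomial.homogeneousComponent_isHomogeneous i p)
  unfold evalAt
  have h3 : (fun j => (c • v) j) = c • (fun j => v j) := by ext j; simp
  rw [h3]
  rw [MvPolynomial.eval_eq', MvPolynomial.eval_eq', Finset.mul_sum]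
  refine Finset.sum_congr rfl fun m hm => ?_
  have hd := this (MvPolynomial.mem_support_iff.1 hm)
  simp only [Pi.smul_apply, smul_eq_mul, mul_pow, Finset.prod_mul_distrib]
  rw [Finset.prod_pow_eq_pow_sum]
  have : ∑ j, m j = i := by
    rw [← hd, Finsupp.weight_apply, Finsupp.sum_fintype _ _ (by simp)]; simp
  rw [this]; ring

lemma exists_proj {r : ℕ} (v : EuclideanSpace ℂ (Fin r)) (hv : v ≠ 0) :
    ∃ r' : ℕ, r' < r ∧ ∃ l : EuclideanSpace ℂ (Fin r) →ₗ[ℂ] EuclideanSpace ℂ (Fin r'),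
      ∀ u, l u = 0 → ∃ c : ℂ, u = c • v := by
  have h1 := Submodule.finrank_quotient_add_finrank (Submodule.span ℂ {v})
  rw [finrank_span_singleton hv, finrank_euclideanSpace_fin] at h1
  refine ⟨r - 1, by omega, ?_⟩
  have h2 : Module.finrank ℂ (EuclideanSpace ℂ (Fin r) ⧸ Submodule.span ℂ {v})
      = Module.finrank ℂ (EuclideanSpace ℂ (Fin (r - 1))) := by
    rw [finrank_euclideanSpace_fin]; omega
  let e := LinearEquiv.ofFinrankEq _ _ h2
  refine ⟨e.toLinearMap ∘ₗ (Submodule.span ℂ {v}).mkQ, fun u hu => ?_⟩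
  have : (Submodule.span ℂ {v}).mkQ u = 0 := by
    apply e.injective
    simpa using hu
  rw [Submodule.mkQ_apply, Submodule.Quotient.mk_eq_zero, Submodule.mem_span_singleton] at this
  obtain ⟨c, hc⟩ := this
  exact ⟨c, hc.symm⟩

lemma zero_set_bound {r r' : ℕ} (P : MvPolynomial (Fin r) ℂ) (v : EuclideanSpace ℂ (Fin r))
    (hv : evalAt v (MvPolynomial.homogeneousComponent P.totalDegree P) ≠ 0)
    (l : EuclideanSpace ℂ (Fin r) →ₗ[ℂ] EuclideanSpace ℂ (Fin r'))
    (hl : ∀ u, l u = 0 → ∃ c : ℂ, u = c • v) :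
    ∃ C : ℝ, 0 < C ∧ ∀ y, evalAt y P = 0 → ‖y‖ ≤ C * (1 + ‖l y‖) := by
  by_contra hcon
  push Not at hcon
  have hcon' : ∀ m : ℕ, ∃ y, evalAt y P = 0 ∧ ((m : ℝ) + 1) * (1 + ‖l y‖) < ‖y‖ :=
    fun m => hcon (m + 1) (by positivity)
  choose y hy0 hy using hcon'
  have hpos : ∀ m, 0 < ‖y m‖ := fun m => lt_of_le_of_lt (by positivity) (hy m)
  set u : ℕ → EuclideanSpace ℂ (Fin r) := fun m => ((‖y m‖⁻¹ : ℝ) : ℂ) • y m with hu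
  have hus : ∀ m, u m ∈ sphere (0 : EuclideanSpace ℂ (Fin r)) 1 := by
    intro m
    rw [mem_sphere_zero_iff_norm, hu]
    simp only [norm_smul, Complex.norm_real, norm_inv, norm_norm]
    exact inv_mul_cancel₀ (hpos m).ne'
  obtain ⟨u0, hu0, φ, hφ, hlim⟩ := (isCompact_sphere _ _).tendsto_subseq hus
  have hly : Tendsto (fun m : ℕ => ‖y m‖) atTop atTop := by
    apply tendsto_atTop_mono (f := fun m : ℕ => (m : ℝ)) _ tendsto_natCast_atTop_atTop
    intro m
    nlinarith [hy m, norm_nonneg (l (y m)), (Nat.cast_nonneg m : (0 : ℝ) ≤ m)]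
  have hlu : Tendsto (fun m => l (u m)) atTop (nhds 0) := by
    apply squeeze_zero_norm (a := fun m : ℕ => 1 / ((m : ℝ) + 1)) _ tendsto_one_div_add_atTop_nhds_zero_nat
    intro m
    rw [hu]
    simp only [map_smul, norm_smul, Complex.norm_real, norm_inv, norm_norm]
    rw [inv_mul_eq_div, div_le_div_iff₀ (hpos m) (by positivity)]
    nlinarith [hy m, norm_nonneg (l (y m)), (Nat.cast_nonneg m : (0 : ℝ) ≤ m)]
  have hcont : Continuous l := l.continuous_of_finiteDimensional
  have hl0 : l u0 = 0 :=
    tendsto_nhds_unique ((hcont.tendsto u0).comp hlim) (hlu.comp hφ.tendsto_atTop)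
  obtain ⟨c, hc⟩ := hl u0 hl0
  have ht := evalAt_scaled_tendsto P (fun m => ‖y (φ m)‖) (hly.comp hφ.tendsto_atTop)
    (u ∘ φ) u0 hlim
  have hz : ∀ m, evalAt (((‖y (φ m)‖ : ℝ) : ℂ) • (u ∘ φ) m) P / ((‖y (φ m)‖ : ℝ) : ℂ) ^ P.totalDegree = 0 := by
    intro m
    have : ((‖y (φ m)‖ : ℝ) : ℂ) • (u ∘ φ) m = y (φ m) := by
      simp only [hu, Function.comp, smul_smul]
      rw [← Complex.ofReal_mul, mul_inv_cancel₀ (hpos _).ne']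
      simp
    rw [this, hy0, zero_div]
  simp only [hz] at ht
  have h0 := tendsto_nhds_unique ht tendsto_const_nhds
  rw [hc, evalAt_hom_smul] at h0
  have hc0 : c ≠ 0 := by
    rintro rfl
    rw [zero_smul] at hc
    rw [hc] at hu0
    simp at hu0
  exact (mul_ne_zero (pow_ne_zero _ hc0) hv) h0

lemma linear_noether_aux {n : ℕ} (A : Set (EuclideanSpace ℂ (Fin n))) (hA : A.Nonempty) :
    ∃ r : ℕ, ∃ L : EuclideanSpace ℂ (Fin n) →ₗ[ℂ] EuclideanSpace ℂ (Fin r),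
      (∃ C : ℝ, 0 < C ∧ ∀ z ∈ A, ‖z‖ ≤ C * (1 + ‖L z‖)) ∧
      ∀ P : MvPolynomial (Fin r) ℂ, (∀ z ∈ A, evalAt (L z) P = 0) → P = 0 := by
  classical
  have hex : ∃ r : ℕ, ∃ L : EuclideanSpace ℂ (Fin n) →ₗ[ℂ] EuclideanSpace ℂ (Fin r),
      (∃ C : ℝ, 0 < C ∧ ∀ z ∈ A, ‖z‖ ≤ C * (1 + ‖L z‖)) :=
    ⟨n, LinearMap.id, 1, one_pos, fun z _ => by simp⟩
  obtain ⟨L, C, hC, hL⟩ := Nat.find_spec hex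
  refine ⟨Nat.find hex, L, ⟨C, hC, hL⟩, ?_⟩
  intro P hP
  by_contra hP0
  obtain ⟨v, hv⟩ := exists_leadForm_ne P hP0
  have hk : P.totalDegree ≠ 0 := by
    intro h0
    obtain ⟨z, hz⟩ := hA
    have h1 := hP z hz
    rw [MvPolynomial.totalDegree_eq_zero_iff_eq_C] at h0
    rw [h0] at h1
    simp [evalAt] at h1
    rw [h1] at h0
    exact hP0 (by simpa using h0)
  have hv0 : v ≠ 0 := by
    rintro rfl
    apply hv
    have := evalAt_hom_smul P 0 P.totalDegree 0
    rw [zero_smul, zero_pow hk, zero_mul] at this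
    exact this
  obtain ⟨r', hr', l, hl⟩ := exists_proj v hv0
  obtain ⟨C', hC', hb⟩ := zero_set_bound P v hv l hl
  refine Nat.find_min hex hr' ⟨l ∘ₗ L, C * (1 + C'), by positivity, fun z hz => ?_⟩
  have h1 := hL z hz
  have h2 := hb (L z) (hP z hz)
  rw [LinearMap.comp_apply]
  have h3 : 1 + ‖L z‖ ≤ (1 + C') * (1 + ‖l (L z)‖) := by
    nlinarith [norm_nonneg (l (L z))]
  calc ‖z‖ ≤ C * (1 + ‖L z‖) := h1
    _ ≤ C * ((1 + C') * (1 + ‖l (L z)‖)) := by gcongr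
    _ = _ := by ring

lemma linear_noether {n : ℕ} (A : Set (EuclideanSpace ℂ (Fin n))) (hA : A.Nonempty) :
    ∃ r : ℕ, ∃ G : Fin r → MvPolynomial (Fin n) ℂ, (∀ i, (G i).totalDegree ≤ 1) ∧
      (∃ C : ℝ, 0 < C ∧ ∀ z ∈ A, ‖z‖ ≤ C * (1 + ‖gmap G z‖)) ∧
      ∀ P : MvPolynomial (Fin r) ℂ, (∀ z ∈ A, evalAt (gmap G z) P = 0) → P = 0 := by
  obtain ⟨r, L, h1, h2⟩ := linear_noether_aux A hA
  set G : Fin r → MvPolynomial (Fin n) ℂ := fun i =>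
    ∑ j, MvPolynomial.C (L (EuclideanSpace.single j 1) i) * MvPolynomial.X j with hG
  have hGL : ∀ z, gmap G z = L z := by
    intro z
    ext i
    have hz : z = ∑ j, z j • EuclideanSpace.single j (1 : ℂ) := by
      ext k
      simp [Finset.sum_apply, Pi.single_apply]
    conv_rhs => rw [hz, map_sum]
    simp [gmap, hG, evalAt, mul_comm]
  refine ⟨r, G, ?_, ?_, ?_⟩
  · intro i
    apply MvPolynomial.totalDegree_finsetSum_le
    intro j _
    refine (MvPolynomial.totalDegree_mul _ _).trans ?_
    simp
  · simpa only [hGL] using h1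
  · simpa only [hGL] using h2


lemma pow_equation {R : Type} [CommRing R] [Nontrivial R] (F : Polynomial R) (hF : F.Monic) (s : ℕ) :
    ∃ Q : Polynomial R, Q.Monic ∧ Q.natDegree = F.natDegree ∧
      ∀ {S : Type} [CommRing S] (φ : R →+* S) (t : S), F.eval₂ φ t = 0 → Q.eval₂ φ (t ^ s) = 0 := by
  have := hF.free_adjoinRoot
  have := hF.finite_adjoinRoot
  set x : AdjoinRoot F := AdjoinRoot.root F ^ s with hx
  set Q := (Algebra.lmul R (AdjoinRoot F) x).charpoly with hQ
  have hQ0 : Polynomial.aeval x Q = 0 := by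
    have h1 := LinearMap.aeval_self_charpoly (Algebra.lmul R (AdjoinRoot F) x)
    rw [← hQ, Polynomial.aeval_algHom_apply] at h1
    have := congrArg (fun g => g (1 : AdjoinRoot F)) h1
    simpa using this
  refine ⟨Q, LinearMap.charpoly_monic _, ?_, ?_⟩
  · rw [hQ, LinearMap.charpoly_natDegree, (AdjoinRoot.powerBasis' hF).finrank]
    rfl
  · intro S _ φ t ht
    have h2 := congrArg (AdjoinRoot.lift φ t ht) hQ0
    rw [map_zero, Polynomial.aeval_def, Polynomial.hom_eval₂] at h2
    have h3 : (AdjoinRoot.lift φ t ht).comp (algebraMap R (AdjoinRoot F)) = φ := by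
      ext a
      simp [AdjoinRoot.algebraMap_eq]
    rw [h3] at h2
    simpa [hx] using h2

lemma root_bound (p : Polynomial ℂ) (hp : p.Monic) (c r : ℝ) (hc : 1 ≤ c) (hr : 0 < r)
    (h : ∀ i < p.natDegree, ‖p.coeff i‖ ≤ c * r ^ (p.natDegree - i)) (t : ℂ)
    (ht : p.eval t = 0) : ‖t‖ ≤ p.natDegree * c * r := by
  set m := p.natDegree with hm
  have hm0 : 1 ≤ m := by
    by_contra hcon
    have : p.natDegree = 0 := by omega
    have := hp.natDegree_eq_zero.1 this
    rw [this] at ht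
    simp at ht
  have hm1 : (1 : ℝ) ≤ m := by exact_mod_cast hm0
  have hmc : 1 ≤ (m : ℝ) * c := by nlinarith
  rcases le_total ‖t‖ r with htr | htr
  · nlinarith
  have h1 : t ^ m = - ∑ i ∈ Finset.range m, p.coeff i * t ^ i := by
    rw [Polynomial.eval_eq_sum_range, ← hm, Finset.sum_range_succ] at ht
    have : p.coeff m = 1 := hp
    rw [this, one_mul] at ht
    linear_combination ht
  have ht0 : 0 < ‖t‖ := hr.trans_le htr
  have h2 : ‖t‖ ^ m ≤ ∑ i ∈ Finset.range m, c * r * ‖t‖ ^ (m - 1) := by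
    rw [← norm_pow, h1, norm_neg]
    refine (norm_sum_le _ _).trans (Finset.sum_le_sum fun i hi => ?_)
    have hi' : i < m := Finset.mem_range.1 hi
    rw [norm_mul, norm_pow]
    calc ‖p.coeff i‖ * ‖t‖ ^ i ≤ c * r ^ (m - i) * ‖t‖ ^ i := by gcongr; exact h i hi'
      _ = c * r * (r ^ (m - 1 - i) * ‖t‖ ^ i) := by
          have : m - i = m - 1 - i + 1 := by omega
          rw [this, pow_succ]; ring
      _ ≤ c * r * (‖t‖ ^ (m - 1 - i) * ‖t‖ ^ i) := by gcongr
      _ = c * r * ‖t‖ ^ (m - 1) := by rw [← pow_add]; congr 2; omega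
  rw [Finset.sum_const, Finset.card_range, nsmul_eq_mul] at h2
  have h3 : ‖t‖ ^ m = ‖t‖ * ‖t‖ ^ (m - 1) := by
    rw [← pow_succ']; congr 1; omega
  rw [h3] at h2
  have h4 : ‖t‖ * ‖t‖ ^ (m - 1) ≤ (m * c * r) * ‖t‖ ^ (m - 1) := by linarith
  exact le_of_mul_le_mul_right h4 (by positivity)

lemma int_growth {r : ℕ} (F : Polynomial (MvPolynomial (Fin r) ℂ)) (hF : F.Monic) :
    ∃ C : ℝ, ∃ D : ℕ, 0 < C ∧ 1 ≤ D ∧ ∀ w t, ev w t F = 0 → ‖t‖ ≤ C * (1 + ‖w‖) ^ D := by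
  choose C hC hb using fun i => evalAt_growth (F.coeff i)
  set c : ℝ := 1 + ∑ i ∈ Finset.range F.natDegree, C i with hc
  set D : ℕ := 1 + ∑ i ∈ Finset.range F.natDegree, (F.coeff i).totalDegree with hD
  have hc1 : 1 ≤ c := by
    have : 0 ≤ ∑ i ∈ Finset.range F.natDegree, C i := Finset.sum_nonneg fun i _ => (hC i).le
    linarith
  refine ⟨(F.natDegree + 1) * c, D, by positivity, by omega, fun w t ht => ?_⟩
  have h1 : (1 : ℝ) ≤ 1 + ‖w‖ := by linarith [norm_nonneg w]
  rw [ev_eq] at ht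
  have hnd := hF.natDegree_map (MvPolynomial.eval (fun i => w i))
  have := root_bound _ (hF.map _) c ((1 + ‖w‖) ^ D) hc1 (by positivity) (by
    intro i hi
    rw [hnd] at hi ⊢
    rw [Polynomial.coeff_map]
    have hi' := Finset.mem_range.2 hi
    refine (hb i w).trans ?_
    have e1 : C i ≤ c := by
      have := Finset.single_le_sum (f := C) (fun i _ => (hC i).le) hi'
      linarith
    have e2 : (F.coeff i).totalDegree ≤ D := by
      have := Finset.single_le_sum (f := fun i => (F.coeff i).totalDegree) (fun i _ => Nat.zero_le _) hi'
      omega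
    have e3 : (1 + ‖w‖) ^ (F.coeff i).totalDegree ≤ ((1 + ‖w‖) ^ D) ^ (F.natDegree - i) := by
      rw [← pow_mul]
      apply pow_le_pow_right₀ h1
      have : 1 ≤ F.natDegree - i := by omega
      nlinarith
    gcongr) t ht
  rw [hnd] at this
  refine this.trans ?_
  gcongr
  linarith

lemma norm_le_sum_coord {n : ℕ} (z : EuclideanSpace ℂ (Fin n)) : ‖z‖ ≤ ∑ j, ‖z j‖ := by
  have hz : z = ∑ j, z j • EuclideanSpace.single j (1 : ℂ) := by
    ext k
    simp [Finset.sum_apply, Pi.single_apply]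
  conv_lhs => rw [hz]
  refine (norm_sum_le _ _).trans (Finset.sum_le_sum fun j _ => ?_)
  rw [norm_smul]; simp

lemma proper_growth {n r : ℕ} {A : Set (EuclideanSpace ℂ (Fin n))} (halg : IsAlgebraicSet A)
    (hprime : (vanishIdeal A).IsPrime) (G : Fin r → MvPolynomial (Fin n) ℂ)
    (hinj : ∀ P : MvPolynomial (Fin r) ℂ, (∀ z ∈ A, evalAt (gmap G z) P = 0) → P = 0)
    (hprop : ∀ R : ℝ, ∃ B : ℝ, ∀ z ∈ A, ‖gmap G z‖ ≤ R → ‖z‖ ≤ B) :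
    ∃ C : ℝ, ∃ D : ℕ, 0 < C ∧ 1 ≤ D ∧ ∀ z ∈ A, ‖z‖ ≤ C * (1 + ‖gmap G z‖) ^ D := by
  choose F hF hz _ _ using fun j => monic_eq halg hprime G hinj hprop (MvPolynomial.X j)
  choose C D hC hD hb using fun j => int_growth (F j) (hF j)
  refine ⟨1 + ∑ j, C j, 1 + ∑ j, D j, ?_, by omega, fun z hzA => ?_⟩
  · have : 0 ≤ ∑ j, C j := Finset.sum_nonneg fun i _ => (hC i).le
    linarith
  refine (norm_le_sum_coord z).trans ?_
  have h1 : (1 : ℝ) ≤ 1 + ‖gmap G z‖ := by linarith [norm_nonneg (gmap G z)]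
  calc ∑ j, ‖z j‖ ≤ ∑ j, C j * (1 + ‖gmap G z‖) ^ (1 + ∑ j, D j) := by
        refine Finset.sum_le_sum fun j _ => ?_
        have := hb j _ _ (hz j z hzA)
        simp only [evalAt, MvPolynomial.eval_X] at this
        refine this.trans ?_
        have : D j ≤ 1 + ∑ j, D j := by
          have := Finset.single_le_sum (f := D) (fun i _ => Nat.zero_le _) (Finset.mem_univ j)
          omega
        have := hC j
        gcongr
    _ = (∑ j, C j) * (1 + ‖gmap G z‖) ^ (1 + ∑ j, D j) := by rw [Finset.sum_mul]
    _ ≤ _ := by gcongr; linarith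

lemma finite_of_zero {n : ℕ} {A : Set (EuclideanSpace ℂ (Fin n))} (halg : IsAlgebraicSet A)
    (hprime : (vanishIdeal A).IsPrime) (G : Fin 0 → MvPolynomial (Fin n) ℂ)
    (hinj : ∀ P : MvPolynomial (Fin 0) ℂ, (∀ z ∈ A, evalAt (gmap G z) P = 0) → P = 0)
    (hprop : ∀ R : ℝ, ∃ B : ℝ, ∀ z ∈ A, ‖gmap G z‖ ≤ R → ‖z‖ ≤ B) : A.Finite := by
  choose F hF hz _ _ using fun j => monic_eq halg hprime G hinj hprop (MvPolynomial.X j)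
  have hfin : (Set.univ.pi fun j : Fin n => {t : ℂ | ev 0 t (F j) = 0}).Finite := by
    apply Set.Finite.pi
    intro j
    have := Polynomial.finite_setOf_isRoot ((hF j).map (MvPolynomial.eval
      (fun i => (0 : EuclideanSpace ℂ (Fin 0)) i))).ne_zero
    refine this.subset fun t ht => ?_
    simp only [Set.mem_setOf_eq, ev_eq] at ht
    exact ht
  refine (hfin.preimage (f := fun z : EuclideanSpace ℂ (Fin n) => z.ofLp)
    (WithLp.ofLp_injective 2).injOn).subset ?_
  intro z hzA j _
  have := hz j z hzA
  rw [Subsingleton.elim (gmap G z) 0] at this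
  simpa [evalAt] using this

lemma unbounded_of {n r : ℕ} {A : Set (EuclideanSpace ℂ (Fin n))} (halg : IsAlgebraicSet A)
    (G : Fin r → MvPolynomial (Fin n) ℂ) (hr : r ≠ 0)
    (hsurj : ∀ w, ∃ z ∈ A, gmap G z = w) (R : ℝ) : ∃ z ∈ A, R < ‖z‖ := by
  by_contra hcon
  push Not at hcon
  have hc : IsCompact A := by
    refine Metric.isCompact_of_isClosed_isBounded halg.isClosed ?_
    exact (Metric.isBounded_closedBall (x := (0 : EuclideanSpace ℂ (Fin n))) (r := R)).subset
      fun z hz => by simpa using hcon z hz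
  have h2 := hc.image (gmap_continuous G)
  obtain ⟨B, hB⟩ := h2.isBounded.exists_norm_le
  set i : Fin r := ⟨0, by omega⟩
  obtain ⟨z, hz, hw⟩ := hsurj (EuclideanSpace.single i ((|B| + 1 : ℝ) : ℂ))
  have := hB _ ⟨z, hz, rfl⟩
  rw [hw] at this
  simp only [PiLp.norm_single, Complex.norm_real, Real.norm_eq_abs] at this
  rw [abs_of_pos (by positivity)] at this
  linarith [le_abs_self B]


lemma logRatio_lt {E F : Type*} [Norm E] [Norm F] (f : E → F) (z : E) (a : ℝ)
    (hz : 1 < ‖z‖) (hf0 : 0 ≤ ‖f z‖) (h : logRatio f z < (a : EReal)) : ‖f z‖ ≤ ‖z‖ ^ a := by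
  rcases hf0.eq_or_lt with h0 | h0
  · rw [← h0]; positivity
  have hl : 0 < Real.log ‖z‖ := Real.log_pos hz
  unfold logRatio elog at h
  rw [if_neg h0.ne', if_neg (by linarith), ← EReal.coe_div, EReal.coe_lt_coe_iff,
    div_lt_iff₀ hl] at h
  rw [← Real.log_le_log_iff h0 (by positivity), Real.log_rpow (by linarith)]
  exact h.le

lemma lt_logRatio {E F : Type*} [Norm E] [Norm F] (f : E → F) (z : E) (a : ℝ)
    (hz : 1 < ‖z‖) (hf0 : 0 ≤ ‖f z‖) (h : (a : EReal) < logRatio f z) : ‖z‖ ^ a ≤ ‖f z‖ := by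
  have hl : 0 < Real.log ‖z‖ := Real.log_pos hz
  rcases hf0.eq_or_lt with h0 | h0
  · exfalso
    unfold logRatio elog at h
    rw [if_pos h0.symm, if_neg (by linarith),
      EReal.bot_div_of_pos_ne_top (by exact_mod_cast hl) (EReal.coe_ne_top _)] at h
    simp at h
  unfold logRatio elog at h
  rw [if_neg h0.ne', if_neg (by linarith), ← EReal.coe_div, EReal.coe_lt_coe_iff,
    lt_div_iff₀ hl] at h
  rw [← Real.log_le_log_iff (by positivity) h0, Real.log_rpow (by linarith)]
  exact h.le

lemma eventually_atInftyOn {E : Type*} [Norm E] {V : Set E} {p : E → Prop}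
    (h : ∀ᶠ z in atInftyOn V, p z) : ∃ R : ℝ, 1 < R ∧ ∀ z ∈ V, R ≤ ‖z‖ → p z := by
  unfold atInftyOn at h
  rw [Filter.eventually_inf_principal, Filter.eventually_comap] at h
  obtain ⟨R, hR⟩ := Filter.eventually_atTop.1 h
  exact ⟨max R 2, by simp, fun z hz hz2 => hR ‖z‖ (le_trans (le_max_left _ _) hz2) z rfl hz⟩

lemma lim_bounds {E F : Type*} [Norm E] [SeminormedAddCommGroup F] {V : Set E} {f : E → F} {d : ℝ}
    (hlim : Filter.Tendsto (logRatio f) (atInftyOn V) (nhds (d : EReal))) {ε : ℝ} (hε : 0 < ε) :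
    ∃ R : ℝ, 1 < R ∧ ∀ z ∈ V, R ≤ ‖z‖ → ‖z‖ ^ (d - ε) ≤ ‖f z‖ ∧ ‖f z‖ ≤ ‖z‖ ^ (d + ε) := by
  have h1 : ∀ᶠ z in atInftyOn V, logRatio f z < ((d + ε : ℝ) : EReal) :=
    hlim.eventually_lt_const (by exact_mod_cast (by linarith : d < d + ε))
  have h2 : ∀ᶠ z in atInftyOn V, ((d - ε : ℝ) : EReal) < logRatio f z :=
    hlim.eventually_const_lt (by exact_mod_cast (by linarith : d - ε < d))
  obtain ⟨R, hR, h⟩ := eventually_atInftyOn (h1.and h2)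
  refine ⟨R, hR, fun z hz hz2 => ?_⟩
  obtain ⟨a, b⟩ := h z hz hz2
  exact ⟨lt_logRatio f z _ (by linarith) (norm_nonneg _) b,
    logRatio_lt f z _ (by linarith) (norm_nonneg _) a⟩

lemma d_pos {E F : Type*} [Norm E] [SeminormedAddCommGroup F] {V : Set E} {f : E → F} {d : ℝ}
    (hlim : Filter.Tendsto (logRatio f) (atInftyOn V) (nhds (d : EReal)))
    (hunb : ∀ R : ℝ, ∃ z ∈ V, R < ‖z‖)
    (hg : ∃ C : ℝ, ∃ D : ℕ, 0 < C ∧ 1 ≤ D ∧ ∀ z ∈ V, ‖z‖ ≤ C * (1 + ‖f z‖) ^ D) : 0 < d := by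
  obtain ⟨C, D, hC, hD, hb⟩ := hg
  by_contra hd
  push Not at hd
  have hD' : (0 : ℝ) < D := by exact_mod_cast hD
  obtain ⟨R, hR, h⟩ := lim_bounds hlim (ε := 1 / (2 * D)) (by positivity)
  obtain ⟨z, hz, hzR⟩ := hunb (max R ((C * 2 ^ D) ^ 2))
  have hzR1 : R < ‖z‖ := lt_of_le_of_lt (le_max_left _ _) hzR
  have hzR2 : (C * 2 ^ D) ^ 2 < ‖z‖ := lt_of_le_of_lt (le_max_right _ _) hzR
  have hz1 : 1 < ‖z‖ := by linarith
  have h1 : ‖f z‖ ≤ ‖z‖ ^ (1 / (2 * D) : ℝ) := (h z hz hzR1.le).2.trans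
    (Real.rpow_le_rpow_of_exponent_le hz1.le (by linarith))
  have h2 : 1 ≤ ‖z‖ ^ (1 / (2 * D) : ℝ) := Real.one_le_rpow hz1.le (by positivity)
  have h3 : ‖z‖ ≤ C * (2 * ‖z‖ ^ (1 / (2 * D) : ℝ)) ^ D := by
    refine (hb z hz).trans ?_
    gcongr
    linarith
  have h4 : (‖z‖ ^ (1 / (2 * D) : ℝ)) ^ D = Real.sqrt ‖z‖ := by
    rw [← Real.rpow_natCast, ← Real.rpow_mul (by linarith), Real.sqrt_eq_rpow]
    congr 1
    field_simp
  rw [mul_pow, h4] at h3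
  have h5 : C * 2 ^ D < Real.sqrt ‖z‖ := Real.lt_sqrt_of_sq_lt hzR2
  have h6 : Real.sqrt ‖z‖ * Real.sqrt ‖z‖ = ‖z‖ := Real.mul_self_sqrt (by linarith)
  have h7 : 0 < Real.sqrt ‖z‖ := Real.sqrt_pos.2 (by linarith)
  nlinarith

/-- upper growth bound -/
lemma growth_up {n r : ℕ} {A : Set (EuclideanSpace ℂ (Fin n))} (G : Fin r → MvPolynomial (Fin n) ℂ)
    {f : EuclideanSpace ℂ (Fin n) → EuclideanSpace ℂ (Fin r)} (hf : ∀ z ∈ A, f z = gmap G z)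
    {d : ℝ} (hd : 0 < d)
    (hlim : Filter.Tendsto (logRatio f) (atInftyOn A) (nhds (d : EReal))) {ε : ℝ} (hε : 0 < ε) :
    ∃ C : ℝ, 0 < C ∧ ∀ z ∈ A, 1 + ‖gmap G z‖ ≤ C * (1 + ‖z‖) ^ (d + ε) := by
  obtain ⟨R, hR, h⟩ := lim_bounds hlim hε
  obtain ⟨B, hB⟩ := ((isCompact_closedBall (0 : EuclideanSpace ℂ (Fin n)) R).image
    (gmap_continuous G)).isBounded.exists_norm_le
  refine ⟨2 + |B|, by positivity, fun z hz => ?_⟩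
  have hz1 : (1 : ℝ) ≤ 1 + ‖z‖ := by linarith [norm_nonneg z]
  have h1 : 1 ≤ (1 + ‖z‖) ^ (d + ε) := Real.one_le_rpow hz1 (by positivity)
  rcases le_total R ‖z‖ with hc | hc
  · have := (h z hz hc).2
    rw [hf z hz] at this
    have h2 : ‖z‖ ^ (d + ε) ≤ (1 + ‖z‖) ^ (d + ε) :=
      Real.rpow_le_rpow (norm_nonneg _) (by linarith) (by positivity)
    nlinarith [abs_nonneg B]
  · have := hB (gmap G z) ⟨z, by simpa using hc, rfl⟩
    nlinarith [abs_nonneg B, le_abs_self B]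

/-- lower growth bound -/
lemma growth_lo {n r : ℕ} {A : Set (EuclideanSpace ℂ (Fin n))} (G : Fin r → MvPolynomial (Fin n) ℂ)
    {f : EuclideanSpace ℂ (Fin n) → EuclideanSpace ℂ (Fin r)} (hf : ∀ z ∈ A, f z = gmap G z)
    {d : ℝ} (hd : 0 < d)
    (hlim : Filter.Tendsto (logRatio f) (atInftyOn A) (nhds (d : EReal))) {ε : ℝ} (hε : 0 < ε) :
    ∃ C : ℝ, 0 < C ∧ ∀ z ∈ A, 1 + ‖z‖ ≤ C * (1 + ‖gmap G z‖) ^ (d⁻¹ + ε) := by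
  -- choose ε' with 1/(d-ε') = 1/d + ε
  set a : ℝ := (d⁻¹ + ε)⁻¹ with ha
  have ha0 : 0 < a := by positivity
  have had : a < d := by
    rw [ha, inv_lt_comm₀ (by positivity) hd]
    linarith
  obtain ⟨R, hR, h⟩ := lim_bounds hlim (ε := d - a) (by linarith)
  refine ⟨2 + R, by linarith, fun z hz => ?_⟩
  have hz1 : (1 : ℝ) ≤ 1 + ‖gmap G z‖ := by linarith [norm_nonneg (gmap G z)]
  have h1 : 1 ≤ (1 + ‖gmap G z‖) ^ (d⁻¹ + ε) := Real.one_le_rpow hz1 (by positivity)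
  rcases le_total R ‖z‖ with hc | hc
  · have := (h z hz hc).1
    rw [hf z hz, _root_.sub_sub_cancel] at this
    have h2 : ‖z‖ ≤ (1 + ‖gmap G z‖) ^ (d⁻¹ + ε) := by
      calc ‖z‖ = (‖z‖ ^ a) ^ (d⁻¹ + ε) := by
            rw [← Real.rpow_mul (norm_nonneg _), ha, inv_mul_cancel₀ (by positivity), Real.rpow_one]
        _ ≤ _ := Real.rpow_le_rpow (by positivity) (by linarith) (by positivity)
    nlinarith
  · nlinarith


lemma growth_comp {E : Type*} {A : Set E} (X Y : E → ℝ) (hX : ∀ z, 0 ≤ X z) (hY : ∀ z, 0 ≤ Y z)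
    (a : ℝ) (h : ∀ ε > 0, ∃ C : ℝ, 0 < C ∧ ∀ z ∈ A, 1 + X z ≤ C * (1 + Y z) ^ (a + ε))
    (j : ℕ) (hj : 1 ≤ j) :
    ∀ ε > 0, ∃ C : ℝ, 0 < C ∧ ∀ z ∈ A, (1 + X z) ^ j ≤ C * (1 + Y z) ^ (j * a + ε) := by
  intro ε hε
  have hj' : (0 : ℝ) < j := by exact_mod_cast hj
  obtain ⟨C, hC, hb⟩ := h (ε / j) (by positivity)
  refine ⟨C ^ j, by positivity, fun z hz => ?_⟩
  have h1 : 0 ≤ 1 + X z := by linarith [hX z]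
  have h2 : 0 ≤ 1 + Y z := by linarith [hY z]
  calc (1 + X z) ^ j ≤ (C * (1 + Y z) ^ (a + ε / j)) ^ j := pow_le_pow_left₀ h1 (hb z hz) j
    _ = _ := by
      rw [mul_pow, ← Real.rpow_natCast ((1 + Y z) ^ (a + ε / j)), ← Real.rpow_mul h2]
      congr 2
      field_simp

lemma le_of_pow_le {x y c : ℝ} (hy : 0 < y) (h : ∀ s : ℕ, 1 ≤ s → x ^ s ≤ c * y ^ s) :
    x ≤ y := by
  by_contra hcon
  push Not at hcon
  have h1 : 1 < x / y := (one_lt_div hy).2 hcon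
  obtain ⟨s, hs⟩ := pow_unbounded_of_one_lt c h1
  have h2 := h (s + 1) (by omega)
  rw [← div_le_iff₀ (by positivity), ← div_pow] at h2
  have h3 : (x / y) ^ s ≤ (x / y) ^ (s + 1) := pow_le_pow_right₀ h1.le (by omega)
  linarith

lemma greenV_nonneg {n : ℕ} (hn : n ≠ 0) {K : Set (EuclideanSpace ℂ (Fin n))} (hK : IsCompact K)
    (z : EuclideanSpace ℂ (Fin n)) : 0 ≤ greenV K z := by
  set i : Fin n := ⟨0, by omega⟩
  obtain ⟨B, hB⟩ := (hK.image (evalAt_continuous (MvPolynomial.X i))).isBounded.exists_norm_le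
  set c : ℂ := (((|B| + 1 : ℝ) : ℂ))⁻¹ with hc
  have hb0 : (0 : ℝ) < |B| + 1 := by positivity
  have hc0 : c ≠ 0 := by
    rw [hc]; exact inv_ne_zero (by exact_mod_cast hb0.ne')
  have hcn : ‖c‖ = (|B| + 1)⁻¹ := by
    rw [hc, norm_inv, Complex.norm_real, Real.norm_eq_abs, abs_of_pos hb0]
  have hmem := le_sSup (α := EReal) (s := {x : EReal | ∃ q : MvPolynomial (Fin n) ℂ, 1 ≤ q.totalDegree ∧
    (∀ w ∈ K, ‖evalAt w q‖ ≤ 1) ∧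
    x = (((q.totalDegree : ℝ)⁻¹ * max (Real.log ‖evalAt z q‖) 0 : ℝ) : EReal)})
    ⟨MvPolynomial.C c * MvPolynomial.X i, by
      rw [MvPolynomial.C_mul_X_eq_monomial, MvPolynomial.totalDegree_monomial _ hc0]; simp, by
      intro w hw
      have := hB _ ⟨w, hw, rfl⟩
      have e : evalAt w (MvPolynomial.C c * MvPolynomial.X i) = c * evalAt w (MvPolynomial.X i) := by
        simp [evalAt]
      rw [e, norm_mul, hcn, inv_mul_le_iff₀ hb0]
      linarith [le_abs_self B], rfl⟩
  refine le_trans ?_ hmem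
  exact_mod_cast (by positivity : (0 : ℝ) ≤ _)

lemma le_greenV {n : ℕ} {K : Set (EuclideanSpace ℂ (Fin n))} (z : EuclideanSpace ℂ (Fin n))
    (q : MvPolynomial (Fin n) ℂ) (h1 : 1 ≤ q.totalDegree) (h2 : ∀ w ∈ K, ‖evalAt w q‖ ≤ 1) :
    ((((q.totalDegree : ℝ)⁻¹ * max (Real.log ‖evalAt z q‖) 0 : ℝ)) : EReal) ≤ greenV K z := by
  unfold greenV
  apply le_sSup
  exact ⟨q, h1, h2, rfl⟩

lemma green_bound {n : ℕ} {K : Set (EuclideanSpace ℂ (Fin n))} (hK : K.Nonempty)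
    (z : EuclideanSpace ℂ (Fin n)) (v : ℝ) (hv : 0 ≤ v) (hg : greenV K z ≤ (v : EReal))
    (q : MvPolynomial (Fin n) ℂ) (B D : ℝ) (hB : 0 < B) (hD : (q.totalDegree : ℝ) ≤ D)
    (hq : ∀ w ∈ K, ‖evalAt w q‖ ≤ B) : ‖evalAt z q‖ ≤ B * Real.exp (D * v) := by
  have hD0 : 0 ≤ D := le_trans (Nat.cast_nonneg _) hD
  rcases Nat.eq_zero_or_pos q.totalDegree with h0 | h0
  · obtain ⟨w, hw⟩ := hK
    have h1 := MvPolynomial.totalDegree_eq_zero_iff_eq_C.1 h0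
    have h2 := hq w hw
    have h3 : evalAt z q = evalAt w q := by
      rw [h1]; simp [evalAt]
    rw [h3]
    have h4 : 1 ≤ Real.exp (D * v) := Real.one_le_exp (by positivity)
    nlinarith
  set q' : MvPolynomial (Fin n) ℂ := MvPolynomial.C (((B : ℝ) : ℂ)⁻¹) * q with hq'
  have hBc : ((B : ℝ) : ℂ) ≠ 0 := by exact_mod_cast hB.ne'
  have hdeg : q'.totalDegree = q.totalDegree := by
    apply le_antisymm
    · refine (MvPolynomial.totalDegree_mul _ _).trans ?_
      simp
    · have : q = MvPolynomial.C ((B : ℝ) : ℂ) * q' := by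
        rw [hq', ← mul_assoc, ← MvPolynomial.C_mul, mul_inv_cancel₀ hBc, MvPolynomial.C_1, one_mul]
      conv_lhs => rw [this]
      refine (MvPolynomial.totalDegree_mul _ _).trans ?_
      simp
  have hev : ∀ w, ‖evalAt w q'‖ = ‖evalAt w q‖ / B := by
    intro w
    simp [hq', evalAt, abs_of_pos hB, inv_mul_eq_div]
  have h1 : ((((q'.totalDegree : ℝ)⁻¹ * max (Real.log ‖evalAt z q'‖) 0 : ℝ)) : EReal) ≤ v :=
    le_trans (le_greenV z q' (by omega) (fun w hw => by
      rw [hev, div_le_one hB]; exact hq w hw)) hg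
  rw [EReal.coe_le_coe_iff, hdeg, hev, inv_mul_le_iff₀ (by exact_mod_cast h0)] at h1
  have h2 := (le_max_left _ _).trans h1
  rcases (norm_nonneg (evalAt z q)).eq_or_lt with h3 | h3
  · rw [← h3]; positivity
  have h4 := (Real.log_le_iff_le_exp (by positivity)).1 h2
  rw [div_le_iff₀ hB] at h4
  refine h4.trans ?_
  rw [mul_comm]
  gcongr

lemma evalAt_aeval {n r : ℕ} (G : Fin r → MvPolynomial (Fin n) ℂ) (a : MvPolynomial (Fin r) ℂ)
    (z : EuclideanSpace ℂ (Fin n)) :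
    evalAt z (MvPolynomial.aeval G a) = evalAt (gmap G z) a := by
  have := evalAt_substHom G 0 z (Polynomial.C a)
  simpa [substHom, ev, evHom, evalAt] using this

lemma totalDegree_aeval_linear {n r : ℕ} (G : Fin r → MvPolynomial (Fin n) ℂ)
    (hG : ∀ i, (G i).totalDegree ≤ 1) (a : MvPolynomial (Fin r) ℂ) :
    (MvPolynomial.aeval G a).totalDegree ≤ a.totalDegree := by
  choose C hC hb using fun i => evalAt_growth (G i)
  obtain ⟨C', hC', hb'⟩ := evalAt_growth a
  set S := ∑ i, C i with hS
  have hS0 : 0 ≤ S := Finset.sum_nonneg fun i _ => (hC i).le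
  have h1 : ∀ z, ‖gmap G z‖ ≤ S * (1 + ‖z‖) := by
    intro z
    refine (norm_le_sum_coord _).trans ?_
    rw [hS, Finset.sum_mul]
    refine Finset.sum_le_sum fun i _ => ?_
    refine (hb i z).trans ?_
    have : (1 + ‖z‖) ^ (G i).totalDegree ≤ (1 + ‖z‖) ^ 1 :=
      pow_le_pow_right₀ (by linarith [norm_nonneg z]) (hG i)
    rw [pow_one] at this
    have := hC i
    gcongr
  have := totalDegree_le_of_growth (MvPolynomial.aeval G a) (C' * (1 + S) ^ a.totalDegree)
    (a.totalDegree : ℝ) (by positivity) (by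
      intro z
      rw [evalAt_aeval, Real.rpow_natCast, mul_assoc, ← mul_pow]
      refine (hb' _).trans ?_
      gcongr
      nlinarith [h1 z, norm_nonneg z])
  exact_mod_cast this

lemma power_reduction {n r : ℕ} {A : Set (EuclideanSpace ℂ (Fin n))}
    (G : Fin r → MvPolynomial (Fin n) ℂ) (hG : ∀ i, (G i).totalDegree ≤ 1)
    (h : MvPolynomial (Fin n) ℂ) (F : Polynomial (MvPolynomial (Fin r) ℂ)) (hF : F.Monic)
    (hz : ∀ z ∈ A, ev (gmap G z) (evalAt z h) F = 0) (ρ : ℝ) (hρ : 0 ≤ ρ)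
    (hc : ∀ i, ((F.coeff i).totalDegree : ℝ) ≤ (F.natDegree - i : ℕ) * ρ) (s : ℕ) :
    ∃ q : MvPolynomial (Fin n) ℂ, (q.totalDegree : ℝ) ≤ s * ρ + (F.natDegree * h.totalDegree : ℕ) ∧
      ∀ z ∈ A, evalAt z q = evalAt z h ^ s := by
  set m := F.natDegree with hm
  induction s using Nat.strong_induction_on with
  | _ s ih =>
  rcases lt_or_ge s m with hsm | hsm
  · refine ⟨h ^ s, ?_, fun z _ => by simp [evalAt]⟩
    have h1 : (h ^ s).totalDegree ≤ m * h.totalDegree :=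
      (MvPolynomial.totalDegree_pow _ _).trans (Nat.mul_le_mul_right _ hsm.le)
    have h2 : ((h ^ s).totalDegree : ℝ) ≤ (m * h.totalDegree : ℕ) := by exact_mod_cast h1
    have : 0 ≤ s * ρ := by positivity
    linarith
  · have hch : ∀ i : Fin m, ∃ q : MvPolynomial (Fin n) ℂ,
        (q.totalDegree : ℝ) ≤ (s - m + i : ℕ) * ρ + (m * h.totalDegree : ℕ) ∧
        ∀ z ∈ A, evalAt z q = evalAt z h ^ (s - m + i : ℕ) := fun i => ih _ (by have := i.2; omega)
    choose q hq1 hq2 using hch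
    refine ⟨- ∑ i : Fin m, MvPolynomial.aeval G (F.coeff i) * q i, ?_, ?_⟩
    · rw [MvPolynomial.totalDegree_neg]
      have hle : ∀ i : Fin m, ((MvPolynomial.aeval G (F.coeff i) * q i).totalDegree : ℝ)
          ≤ s * ρ + (m * h.totalDegree : ℕ) := by
        intro i
        have e1 := MvPolynomial.totalDegree_mul (MvPolynomial.aeval G (F.coeff i)) (q i)
        have e2 := totalDegree_aeval_linear G hG (F.coeff i)
        have e3 : ((MvPolynomial.aeval G (F.coeff i) * q i).totalDegree : ℝ)
          ≤ (F.coeff i).totalDegree + (q i).totalDegree := by exact_mod_cast e1.trans (by omega)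
        have e4 := hc i
        have e5 := hq1 i
        have e6 : ((m - i : ℕ) : ℝ) + (s - m + i : ℕ) = s := by
          have := i.2
          exact_mod_cast (by omega : (m - i : ℕ) + (s - m + i : ℕ) = s)
        calc _ ≤ _ := e3
          _ ≤ (m - i : ℕ) * ρ + ((s - m + i : ℕ) * ρ + (m * h.totalDegree : ℕ)) := by linarith
          _ = (((m - i : ℕ) : ℝ) + (s - m + i : ℕ)) * ρ + (m * h.totalDegree : ℕ) := by ring
          _ = _ := by rw [e6]
      have h0 : (0 : ℝ) ≤ s * ρ + (m * h.totalDegree : ℕ) := by positivity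
      have : (∑ i : Fin m, MvPolynomial.aeval G (F.coeff i) * q i).totalDegree
          ≤ ⌊s * ρ + (m * h.totalDegree : ℕ)⌋₊ := by
        apply MvPolynomial.totalDegree_finsetSum_le
        intro i _
        exact Nat.le_floor (hle i)
      exact (Nat.le_floor_iff h0).1 this
    · intro z hzA
      have h1 := hz z hzA
      rw [ev_eq, Polynomial.eval_eq_sum_range, hF.natDegree_map, ← hm, Finset.sum_range_succ] at h1
      have h2 : (F.map (MvPolynomial.eval fun i => (gmap G z) i)).coeff m = 1 := by
        rw [Polynomial.coeff_map, hm, hF.coeff_natDegree, map_one]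
      rw [h2, one_mul, ← Fin.sum_univ_eq_sum_range
        (fun i => (F.map (MvPolynomial.eval fun i => (gmap G z) i)).coeff i * evalAt z h ^ i)] at h1
      have h3 : evalAt z (- ∑ i : Fin m, MvPolynomial.aeval G (F.coeff i) * q i)
          = - ∑ i : Fin m, evalAt (gmap G z) (F.coeff i) * evalAt z (q i) := by
        have : ∀ i : Fin m, evalAt (gmap G z) (F.coeff i)
          = evalAt z (MvPolynomial.aeval G (F.coeff i)) := fun i => (evalAt_aeval _ _ _).symm
        simp only [this]
        simp only [evalAt, map_neg, map_sum, map_mul]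
      rw [h3]
      have h4 : ∀ i : Fin m, evalAt (gmap G z) (F.coeff i) * evalAt z (q i)
          = evalAt z h ^ (s - m) * ((F.map (MvPolynomial.eval fun i => (gmap G z) i)).coeff i
            * evalAt z h ^ (i : ℕ)) := by
        intro i
        rw [hq2 i z hzA, Polynomial.coeff_map, pow_add]
        simp only [evalAt]
        ring
      simp only [h4]
      rw [← Finset.mul_sum]
      have h5 : evalAt z h ^ s = evalAt z h ^ (s - m) * evalAt z h ^ m := by
        rw [← pow_add]; congr 1; omega
      rw [h5]
      linear_combination (-(evalAt z h ^ (s - m))) * h1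


lemma green_le {n : ℕ} {K : Set (EuclideanSpace ℂ (Fin n))} (z : EuclideanSpace ℂ (Fin n)) (v : ℝ)
    (hv : 0 ≤ v) (h : ∀ q : MvPolynomial (Fin n) ℂ, 1 ≤ q.totalDegree →
      (∀ w ∈ K, ‖evalAt w q‖ ≤ 1) → ‖evalAt z q‖ ≤ Real.exp (q.totalDegree * v)) :
    greenV K z ≤ (v : EReal) := by
  unfold greenV
  apply sSup_le
  rintro x ⟨q, h1, h2, rfl⟩
  have hq : (0 : ℝ) < q.totalDegree := by exact_mod_cast h1
  rw [EReal.coe_le_coe_iff, inv_mul_le_iff₀ hq]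
  refine max_le ?_ (by positivity)
  rcases (norm_nonneg (evalAt z q)).eq_or_lt with h3 | h3
  · rw [← h3, Real.log_zero]; positivity
  exact (Real.log_le_iff_le_exp h3).2 (h q h1 h2)

/-- upper half -/
lemma part_up {N M : ℕ} {A : Set (EuclideanSpace ℂ (Fin N))} (halg : IsAlgebraicSet A)
    (hprime : (vanishIdeal A).IsPrime) (hA : A.Nonempty)
    (P : Fin M → MvPolynomial (Fin N) ℂ)
    (hne : ∀ w, ∃ z ∈ A, gmap P z = w) (d : ℝ) (hd : 0 < d)
    (hup : ∀ ε > 0, ∃ C : ℝ, 0 < C ∧ ∀ z ∈ A, 1 + ‖gmap P z‖ ≤ C * (1 + ‖z‖) ^ (d + ε))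
    (K : Set (EuclideanSpace ℂ (Fin M))) (hK : K.Nonempty) (E : Set (EuclideanSpace ℂ (Fin N)))
    (hE : E = A ∩ gmap P ⁻¹' K) (z : EuclideanSpace ℂ (Fin N)) (hz : z ∈ A) (v : ℝ) (hv : 0 ≤ v)
    (hg : greenV E z ≤ (v : EReal)) : greenV K (gmap P z) ≤ ((d * v : ℝ) : EReal) := by
  have hEne : E.Nonempty := by
    obtain ⟨w, hw⟩ := hK
    obtain ⟨x, hx, hxw⟩ := hne w
    exact ⟨x, by rw [hE]; exact ⟨hx, by rw [Set.mem_preimage, hxw]; exact hw⟩⟩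
  apply green_le _ _ (by positivity)
  intro p hp1 hp2
  set k := p.totalDegree with hk
  set h := MvPolynomial.aeval P p with hh
  obtain ⟨r, G, hG1, ⟨C, hC, hGb⟩, hGinj⟩ := linear_noether A hA
  have hprop : ∀ R : ℝ, ∃ B : ℝ, ∀ z ∈ A, ‖gmap G z‖ ≤ R → ‖z‖ ≤ B := by
    intro R
    refine ⟨C * (1 + R), fun x hx hxR => (hGb x hx).trans ?_⟩
    gcongr
  obtain ⟨F, hF, hFz, hFatt, -⟩ := monic_eq halg hprime G hGinj hprop h
  have hcoef := coeff_degree G h F hF hFatt (k * d) (by positivity) (by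
    intro ε hε
    obtain ⟨C1, hC1, hb1⟩ := growth_comp (fun z => ‖gmap P z‖) (fun z => ‖z‖)
      (fun _ => norm_nonneg _) (fun _ => norm_nonneg _) d hup k hp1 ε hε
    obtain ⟨C2, hC2, hb2⟩ := evalAt_growth p
    refine ⟨C2 * (C1 * (1 + C) ^ (k * d + ε)), fun x hx => ?_⟩
    rw [hh, evalAt_aeval]
    have e1 : 1 + ‖x‖ ≤ (1 + C) * (1 + ‖gmap G x‖) := by
      nlinarith [hGb x hx, norm_nonneg (gmap G x)]
    calc ‖evalAt (gmap P x) p‖ ≤ C2 * (1 + ‖gmap P x‖) ^ k := hb2 _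
      _ ≤ C2 * (C1 * (1 + ‖x‖) ^ (k * d + ε)) := by
          have := hb1 x hx
          gcongr
      _ ≤ C2 * (C1 * ((1 + C) * (1 + ‖gmap G x‖)) ^ (k * d + ε)) := by gcongr
      _ = _ := by rw [Real.mul_rpow (by positivity) (by positivity)]; ring)
  have hred := power_reduction G hG1 h F hF hFz (k * d) (by positivity) hcoef
  rw [← evalAt_aeval]
  apply le_of_pow_le (c := Real.exp ((F.natDegree * h.totalDegree : ℕ) * v)) (Real.exp_pos _)
  intro s _
  obtain ⟨q, hq1, hq2⟩ := hred s
  have := green_bound hEne z v hv hg q 1 _ one_pos hq1 (by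
    intro x hx
    rw [hE] at hx
    rw [hq2 x hx.1, norm_pow, hh, evalAt_aeval]
    exact pow_le_one₀ (norm_nonneg _) (hp2 _ hx.2))
  rw [hq2 z hz, norm_pow, one_mul] at this
  refine this.trans (le_of_eq ?_)
  rw [← Real.exp_nat_mul, ← Real.exp_add]
  congr 1
  ring

/-- lower half -/
lemma part_lo {N M : ℕ} {A : Set (EuclideanSpace ℂ (Fin N))} (halg : IsAlgebraicSet A)
    (hprime : (vanishIdeal A).IsPrime)
    (P : Fin M → MvPolynomial (Fin N) ℂ)
    (hinj : ∀ Q : MvPolynomial (Fin M) ℂ, (∀ z ∈ A, evalAt (gmap P z) Q = 0) → Q = 0)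
    (hprop : ∀ R : ℝ, ∃ B : ℝ, ∀ z ∈ A, ‖gmap P z‖ ≤ R → ‖z‖ ≤ B) (d : ℝ) (hd : 0 < d)
    (hlo : ∀ ε > 0, ∃ C : ℝ, 0 < C ∧ ∀ z ∈ A, 1 + ‖z‖ ≤ C * (1 + ‖gmap P z‖) ^ (d⁻¹ + ε))
    (K : Set (EuclideanSpace ℂ (Fin M))) (hK : K.Nonempty) (E : Set (EuclideanSpace ℂ (Fin N)))
    (hE : E = A ∩ gmap P ⁻¹' K) (z : EuclideanSpace ℂ (Fin N)) (hz : z ∈ A) (v : ℝ) (hv : 0 ≤ v)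
    (hg : greenV K (gmap P z) ≤ (v : EReal)) : greenV E z ≤ ((v / d : ℝ) : EReal) := by
  apply green_le _ _ (by positivity)
  intro q hq1 hq2
  set k := q.totalDegree with hk
  obtain ⟨F0, hF0, hF0z, -, -⟩ := monic_eq halg hprime P hinj hprop q
  set m := F0.natDegree with hm
  apply le_of_pow_le (c := m * 2 ^ m) (Real.exp_pos _)
  intro s hs
  obtain ⟨F, hF, hFz, hFatt, hFmin⟩ := monic_eq halg hprime P hinj hprop (q ^ s)
  have hpow : ∀ x, evalAt x (q ^ s) = evalAt x q ^ s := fun x => by simp [evalAt]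
  have hmm : F.natDegree ≤ m := by
    obtain ⟨Q, hQ, hQd, hQ0⟩ := pow_equation F0 hF0 s
    rw [hm, ← hQd]
    apply hFmin Q hQ.ne_zero
    intro x hx
    rw [hpow]
    exact hQ0 _ _ (hF0z x hx)
  have hks : 1 ≤ k * s := Nat.one_le_iff_ne_zero.2 (by
    have : k ≠ 0 := by omega
    have : s ≠ 0 := by omega
    positivity)
  have hcoef := coeff_degree P (q ^ s) F hF hFatt ((k * s : ℕ) * d⁻¹) (by positivity) (by
    intro ε hε
    obtain ⟨C1, hC1, hb1⟩ := growth_comp (fun z => ‖z‖) (fun z => ‖gmap P z‖)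
      (fun _ => norm_nonneg _) (fun _ => norm_nonneg _) d⁻¹ hlo (k * s) hks ε hε
    obtain ⟨C2, hC2, hb2⟩ := evalAt_growth q
    refine ⟨C2 ^ s * C1, fun x hx => ?_⟩
    rw [hpow, norm_pow]
    calc ‖evalAt x q‖ ^ s ≤ (C2 * (1 + ‖x‖) ^ k) ^ s := by gcongr; exact hb2 x
      _ = C2 ^ s * (1 + ‖x‖) ^ (k * s) := by rw [mul_pow, ← pow_mul]
      _ ≤ C2 ^ s * (C1 * (1 + ‖gmap P x‖) ^ ((k * s : ℕ) * d⁻¹ + ε)) := by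
          have := hb1 x hx
          gcongr
      _ = _ := by ring)
  have hbd : ∀ i, ‖evalAt (gmap P z) (F.coeff i)‖
      ≤ 2 ^ F.natDegree * Real.exp (((F.natDegree - i : ℕ) * ((k * s : ℕ) * d⁻¹)) * v) := by
    intro i
    apply green_bound hK _ v hv hg _ _ _ (by positivity) (hcoef i)
    intro w hw
    apply coeff_bound_on P (q ^ s) F hF hFatt
    intro x hx hxw
    rw [hpow, norm_pow]
    exact pow_le_one₀ (norm_nonneg _) (hq2 x (by
      rw [hE]; exact ⟨hx, by rw [Set.mem_preimage, hxw]; exact hw⟩))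
  have hroot := hFz z hz
  rw [ev_eq, hpow] at hroot
  have hnd := hF.natDegree_map (MvPolynomial.eval (fun i => (gmap P z) i))
  have := root_bound _ (hF.map _) (2 ^ F.natDegree) (Real.exp (((k * s : ℕ) * d⁻¹) * v))
    (one_le_pow₀ (by norm_num)) (Real.exp_pos _) (by
      intro i _
      rw [hnd, Polynomial.coeff_map, ← Real.exp_nat_mul]
      refine (hbd i).trans (le_of_eq ?_)
      congr 2
      ring) _ hroot
  rw [hnd, norm_pow] at this
  refine this.trans ?_
  have e : Real.exp (((k * s : ℕ) * d⁻¹) * v) = Real.exp (k * (v / d)) ^ s := by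
    rw [← Real.exp_nat_mul]
    congr 1
    push_cast
    field_simp
  rw [e]
  gcongr
  norm_num

/-- Let `𝒜 ⊆ ℂᴺ` be an irreducible algebraic set of positive dimension
(equiv., infinite) and `f : 𝒜 → ℂᴹ` a proper polynomial mapping on `𝒜` with `f(𝒜) = ℂᴹ`.
If the limit `d = lim_{𝒜 ∋ z → ∞} log ‖f z‖ / log ‖z‖` exists in `ℝ`, then for every
nonempty compact `K ⊆ ℂᴹ` and every `z ∈ 𝒜`: `V_K(f z) = d · V_{f⁻¹(K)}(z)`. -/
theorem statement17 {N M : ℕ} (A : Set (EuclideanSpace ℂ (Fin N)))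
    (f : EuclideanSpace ℂ (Fin N) → EuclideanSpace ℂ (Fin M))
    (halg : IsAlgebraicSet A) (hprime : (vanishIdeal A).IsPrime) (hinf : A.Infinite)
    (hpoly : IsPolyMapOn f A)
    (hproper : ∀ K : Set (EuclideanSpace ℂ (Fin M)), IsCompact K → IsCompact (A ∩ f ⁻¹' K))
    (hsurj : f '' A = Set.univ)
    (d : ℝ) (hlim : Filter.Tendsto (logRatio f) (atInftyOn A) (nhds (d : EReal))) :
    ∀ K : Set (EuclideanSpace ℂ (Fin M)), K.Nonempty → IsCompact K →
      ∀ z ∈ A, greenV K (f z) = (d : EReal) * greenV (A ∩ f ⁻¹' K) z := by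
  obtain ⟨P, hP⟩ := hpoly
  have hf : ∀ z ∈ A, f z = gmap P z := by
    intro z hz
    ext j
    exact hP z hz j
  have hne : ∀ w, ∃ z ∈ A, gmap P z = w := by
    intro w
    have : w ∈ f '' A := by rw [hsurj]; trivial
    obtain ⟨z, hz, h⟩ := this
    exact ⟨z, hz, by rw [← hf z hz, h]⟩
  have hinj : ∀ Q : MvPolynomial (Fin M) ℂ, (∀ z ∈ A, evalAt (gmap P z) Q = 0) → Q = 0 := by
    intro Q hQ
    apply MvPolynomial.funext
    intro x
    obtain ⟨z, hz, h⟩ := hne (WithLp.toLp 2 x)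
    have := hQ z hz
    rw [h] at this
    simpa [evalAt] using this
  have hpre : ∀ K : Set (EuclideanSpace ℂ (Fin M)), A ∩ f ⁻¹' K = A ∩ gmap P ⁻¹' K := by
    intro K
    ext z
    constructor
    · rintro ⟨h1, h2⟩
      exact ⟨h1, by rw [Set.mem_preimage, ← hf z h1]; exact h2⟩
    · rintro ⟨h1, h2⟩
      exact ⟨h1, by rw [Set.mem_preimage, hf z h1]; exact h2⟩
  have hprop : ∀ R : ℝ, ∃ B : ℝ, ∀ z ∈ A, ‖gmap P z‖ ≤ R → ‖z‖ ≤ B := by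
    intro R
    obtain ⟨B, hB⟩ := (hproper _ (isCompact_closedBall 0 R)).isBounded.exists_norm_le
    refine ⟨B, fun z hz hzR => hB z ?_⟩
    rw [hpre]
    exact ⟨hz, by simpa using hzR⟩
  have hM : M ≠ 0 := by
    rintro rfl
    exact hinf (finite_of_zero halg hprime P hinj hprop)
  have hN : N ≠ 0 := by
    rintro rfl
    exact hinf (Set.toFinite A)
  have hunb := unbounded_of halg P hM hne
  have hd : 0 < d := by
    apply d_pos hlim hunb
    obtain ⟨C, D, hC, hD, hb⟩ := proper_growth halg hprime P hinj hprop
    exact ⟨C, D, hC, hD, fun z hz => by rw [hf z hz]; exact hb z hz⟩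
  intro K hK hKc z hz
  have hEc := hproper K hKc
  set E := A ∩ f ⁻¹' K with hE
  have hE' : E = A ∩ gmap P ⁻¹' K := hpre K
  rw [hf z hz]
  have hn1 : 0 ≤ greenV E z := greenV_nonneg hN hEc z
  have hn2 : 0 ≤ greenV K (gmap P z) := greenV_nonneg hM hKc _
  have hlo : ∀ v : ℝ, greenV K (gmap P z) = (v : EReal) → greenV E z ≤ ((v / d : ℝ) : EReal) := by
    intro v hv
    have hv0 : 0 ≤ v := by rw [hv] at hn2; exact_mod_cast hn2
    exact part_lo halg hprime P hinj hprop d hd (fun ε hε => growth_lo P hf hd hlim hε) K hK E hE'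
      z hz v hv0 hv.le
  by_cases htop : greenV E z = ⊤
  · rw [htop, EReal.coe_mul_top_of_pos hd]
    by_contra hcon
    have hv : greenV K (gmap P z) = ((greenV K (gmap P z)).toReal : EReal) :=
      (EReal.coe_toReal hcon (ne_bot_of_le_ne_bot EReal.zero_ne_bot hn2)).symm
    have := hlo _ hv
    rw [htop] at this
    exact EReal.coe_ne_top _ (top_le_iff.1 this)
  · have hu : greenV E z = ((greenV E z).toReal : EReal) :=
      (EReal.coe_toReal htop (ne_bot_of_le_ne_bot EReal.zero_ne_bot hn1)).symm
    generalize (greenV E z).toReal = u at hu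
    have hu0 : 0 ≤ u := by rw [hu] at hn1; exact_mod_cast hn1
    have h1 := part_up halg hprime hinf.nonempty P hne d hd
      (fun ε hε => growth_up P hf hd hlim hε) K hK E hE' z hz u hu0 hu.le
    have hcon : greenV K (gmap P z) ≠ ⊤ := fun h => by
      rw [h] at h1
      exact EReal.coe_ne_top _ (top_le_iff.1 h1)
    have hv : greenV K (gmap P z) = ((greenV K (gmap P z)).toReal : EReal) :=
      (EReal.coe_toReal hcon (ne_bot_of_le_ne_bot EReal.zero_ne_bot hn2)).symm
    have h2 := hlo _ hv
    generalize (greenV K (gmap P z)).toReal = v at hv h2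
    rw [hv] at h1 ⊢
    rw [hu] at h2 ⊢
    rw [EReal.coe_le_coe_iff] at h1 h2
    rw [← EReal.coe_mul, EReal.coe_eq_coe_iff]
    apply le_antisymm h1
    rw [le_div_iff₀ hd] at h2
    linarith
end

section
/- Let 𝒜 := {(w,z) ∈ ℂ² : w³ = z²} and E := {(w,z) ∈ 𝒜 : |w| ≤ 1 and |z| ≤ 1}. Then for every (w,z) ∈ 𝒜: V_E(w,z) = log⁺|z| = (3/2)·log⁺|w|, where log⁺ t = max(log t, 0). -/
open Filter MvPolynomial Metric Set ENNReal

/-- the cuspidal cubic `𝒜 = {(w,z) ∈ ℂ² : w³ = z²}`. -/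
def cuspCurve : Set (EuclideanSpace ℂ (Fin 2)) := {v | (v 0) ^ 3 = (v 1) ^ 2}

/-- `E = {(w,z) ∈ 𝒜 : |w| ≤ 1 and |z| ≤ 1}`. -/
def cuspE : Set (EuclideanSpace ℂ (Fin 2)) := {v ∈ cuspCurve | ‖v 0‖ ≤ 1 ∧ ‖v 1‖ ≤ 1}

/-- Bernstein–Walsh inequality for the unit disk. -/
lemma bw_disk (P : Polynomial ℂ) (N : ℕ) (hN : P.natDegree ≤ N)
    (h : ∀ u : ℂ, ‖u‖ = 1 → ‖P.eval u‖ ≤ 1) (x : ℂ) (hx : 1 ≤ ‖x‖) :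
    ‖P.eval x‖ ≤ ‖x‖ ^ N := by
  have key : ∀ y : ℂ, y ≠ 0 → (P.reflect N).eval y⁻¹ * y ^ N = P.eval y := by
    intro y hy
    letI : Invertible y := invertibleOfNonzero hy
    have := Polynomial.eval₂_reflect_mul_pow (RingHom.id ℂ) y N P hN
    rw [invOf_eq_inv] at this
    exact this
  have hx0 : x ≠ 0 := by
    rintro rfl
    simp at hx
    linarith
  have hQ : ‖(P.reflect N).eval x⁻¹‖ ≤ 1 := by
    refine Complex.norm_le_of_forall_mem_frontier_norm_le (U := Metric.ball (0:ℂ) 1)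
      (f := fun y => (P.reflect N).eval y) Metric.isBounded_ball
      (Polynomial.differentiable _).diffContOnCl ?_ ?_
    · intro u hu
      rw [frontier_ball (0:ℂ) one_ne_zero, mem_sphere_zero_iff_norm] at hu
      have hu0 : u⁻¹ ≠ 0 := by
        intro h0
        rw [inv_eq_zero] at h0
        simp [h0] at hu
      have h1 := h u⁻¹ (by simp [hu])
      rw [← key u⁻¹ hu0] at h1
      simpa [hu] using h1
    · rw [closure_ball (0:ℂ) one_ne_zero, mem_closedBall_zero_iff, norm_inv]
      exact inv_le_one_of_one_le₀ hx
  rw [← key x hx0, norm_mul, norm_pow]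
  exact mul_le_of_le_one_left (by positivity) hQ

lemma cusp_param (v : EuclideanSpace ℂ (Fin 2)) (hv : v ∈ cuspCurve) :
    ∃ x : ℂ, v 0 = x ^ 2 ∧ v 1 = x ^ 3 := by
  have hv' : (v 0) ^ 3 = (v 1) ^ 2 := hv
  by_cases h0 : v 0 = 0
  · refine ⟨0, by simp [h0], ?_⟩
    rw [h0] at hv'
    simpa using hv'.symm
  · refine ⟨v 1 / v 0, ?_, ?_⟩
    · field_simp
      exact hv'
    · have h1 : v 1 ^ 3 = v 0 ^ 3 * v 1 := by rw [hv']; ring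
      rw [div_pow, h1]
      field_simp

lemma cusp_upper (q : MvPolynomial (Fin 2) ℂ) (hE : ∀ w ∈ cuspE, ‖evalAt w q‖ ≤ 1)
    (v : EuclideanSpace ℂ (Fin 2)) (x : ℂ) (h0 : v 0 = x ^ 2) (h1 : v 1 = x ^ 3)
    (hx : 1 ≤ ‖x‖) : ‖evalAt v q‖ ≤ ‖x‖ ^ (q.totalDegree * 3) := by
  set P : Polynomial ℂ :=
    MvPolynomial.aeval (![Polynomial.X ^ 2, Polynomial.X ^ 3] : Fin 2 → Polynomial ℂ) q with hP
  have hdeg : P.natDegree ≤ q.totalDegree * 3 := by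
    refine MvPolynomial.aeval_natDegree_le q le_rfl _ ?_
    intro i
    fin_cases i <;> simp
  have hev : ∀ (u : EuclideanSpace ℂ (Fin 2)) (y : ℂ), u 0 = y ^ 2 → u 1 = y ^ 3 →
      P.eval y = evalAt u q := by
    intro u y hu0 hu1
    have h2 : (fun i => u i) = ![y ^ 2, y ^ 3] := by
      funext i
      fin_cases i <;> simp [hu0, hu1]
    unfold evalAt
    rw [h2, hP, ← Polynomial.coe_evalRingHom, MvPolynomial.aeval_def, MvPolynomial.hom_eval₂]
    unfold MvPolynomial.eval
    rw [MvPolynomial.coe_eval₂Hom]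
    congr 1
    · ext <;> simp
    · funext i
      fin_cases i <;> simp
  rw [← hev v x h0 h1]
  refine bw_disk P _ hdeg ?_ x hx
  intro u hu
  rw [hev (!₂[u ^ 2, u ^ 3]) u (by simp) (by simp)]
  apply hE
  refine ⟨?_, by simp [hu], by simp [hu]⟩
  show (!₂[u ^ 2, u ^ 3] : EuclideanSpace ℂ (Fin 2)) 0 ^ 3 = (!₂[u ^ 2, u ^ 3] : EuclideanSpace ℂ (Fin 2)) 1 ^ 2
  simp
  ring

lemma cusp_green (v : EuclideanSpace ℂ (Fin 2)) (hv : v ∈ cuspCurve) :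
    greenV cuspE v = ((max (Real.log ‖v 1‖) 0 : ℝ) : EReal) := by
  obtain ⟨x, h0, h1⟩ := cusp_param v hv
  apply le_antisymm
  · apply sSup_le
    rintro _ ⟨q, hd, hE, rfl⟩
    rw [EReal.coe_le_coe_iff]
    have hd' : (0:ℝ) < q.totalDegree := by exact_mod_cast hd
    rw [inv_mul_le_iff₀ hd']
    refine max_le ?_ (by positivity)
    by_cases hx : 1 ≤ ‖x‖
    · have hb := cusp_upper q hE v x h0 h1 hx
      have h3 : Real.log ‖evalAt v q‖ ≤ q.totalDegree * Real.log ‖v 1‖ := by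
        rcases (norm_nonneg (evalAt v q)).eq_or_lt with h | h
        · rw [← h, Real.log_zero, h1, norm_pow]
          exact mul_nonneg hd'.le (Real.log_nonneg (one_le_pow₀ hx))
        · refine (Real.log_le_log h hb).trans_eq ?_
          rw [h1, norm_pow, Real.log_pow, Real.log_pow]
          push_cast
          ring
      exact h3.trans (mul_le_mul_of_nonneg_left (le_max_left _ _) hd'.le)
    · have hx' : ‖x‖ ≤ 1 := (not_le.mp hx).le
      have hvE : v ∈ cuspE := by
        refine ⟨hv, ?_, ?_⟩
        · rw [h0, norm_pow]; exact pow_le_one₀ (norm_nonneg _) hx'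
        · rw [h1, norm_pow]; exact pow_le_one₀ (norm_nonneg _) hx'
      exact (Real.log_nonpos (norm_nonneg _) (hE v hvE)).trans (by positivity)
  · apply le_sSup
    refine ⟨MvPolynomial.X 1, by simp, ?_, ?_⟩
    · intro w hw
      simpa [evalAt] using hw.2.2
    · simp [evalAt]

/-- For `𝒜 = {(w,z) ∈ ℂ² : w³ = z²}` and
`E = {(w,z) ∈ 𝒜 : |w| ≤ 1, |z| ≤ 1}`, every `(w,z) ∈ 𝒜` satisfies
`V_E(w,z) = log⁺ |z| = (3/2)·log⁺ |w|`. -/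
theorem statement18 :
    ∀ v ∈ cuspCurve,
      greenV cuspE v = ((max (Real.log ‖v 1‖) 0 : ℝ) : EReal) ∧
      greenV cuspE v = (((3 / 2 : ℝ) * max (Real.log ‖v 0‖) 0 : ℝ) : EReal) := by
  intro v hv
  have hg := cusp_green v hv
  refine ⟨hg, ?_⟩
  rw [hg]
  obtain ⟨x, h0, h1⟩ := cusp_param v hv
  rw [EReal.coe_eq_coe_iff, h0, h1, norm_pow, norm_pow, Real.log_pow, Real.log_pow]
  push_cast
  rcases le_total 0 (Real.log ‖x‖) with h | h
  · rw [max_eq_left (by linarith), max_eq_left (by linarith)]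
    ring
  · rw [max_eq_right (by linarith), max_eq_right (by linarith)]
    ring
end

section
/- Let p, q ∈ ℂ[t] be nonconstant polynomials of one complex variable with p(0) = q(0) = 0 and deg p = deg q = d. Let 𝒜 := {(w,z) ∈ ℂ² : wz = 0} and E := (p⁻¹(Δ̄) × {0}) ∪ ({0} × q⁻¹(Δ̄)), where Δ̄ is the closed unit disk in ℂ. Then E is compact and for every (w,z) ∈ 𝒜: V_E(w,z) = (1/d)·log⁺|p(w) + q(z)|, where log⁺ t = max(log t, 0). -/
open Filter MvPolynomial Metric Set ENNReal

/-- the union of the two coordinate lines `𝒜 = {(w,z) ∈ ℂ² : wz = 0}`. -/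
def crossSet : Set (EuclideanSpace ℂ (Fin 2)) := {v | v 0 * v 1 = 0}

/-- `E = (p⁻¹(Δ̄) × {0}) ∪ ({0} × q⁻¹(Δ̄))`, where `Δ̄` is the closed unit disk. -/
def crossE (p q : Polynomial ℂ) : Set (EuclideanSpace ℂ (Fin 2)) :=
  {v | ‖Polynomial.eval (v 0) p‖ ≤ 1 ∧ v 1 = 0} ∪ {v | v 0 = 0 ∧ ‖Polynomial.eval (v 1) q‖ ≤ 1}

theorem tendsto_eval_div_zero (A B : Polynomial ℂ) (h : A.natDegree < B.natDegree) :
    Tendsto (fun w : ℂ => A.eval w / B.eval w) (Bornology.cobounded ℂ) (nhds 0) := by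
  set N := B.natDegree with hN
  have hB : B ≠ 0 := by
    rintro rfl
    simp at hN
    omega
  have hA0 : (Polynomial.reflect N A).eval 0 = 0 := by
    rw [← Polynomial.coeff_zero_eq_eval_zero, Polynomial.coeff_reflect, Polynomial.revAt_zero]
    exact Polynomial.coeff_eq_zero_of_natDegree_lt h
  have hB0 : (Polynomial.reflect N B).eval 0 ≠ 0 := by
    rw [← Polynomial.coeff_zero_eq_eval_zero, Polynomial.coeff_reflect, Polynomial.revAt_zero]
    simpa [hN] using hB
  have h1 : Tendsto (fun u : ℂ => (Polynomial.reflect N A).eval u / (Polynomial.reflect N B).eval u)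
      (nhds 0) (nhds 0) := by
    have := ((Polynomial.reflect N A).continuous.tendsto (0 : ℂ)).div
      ((Polynomial.reflect N B).continuous.tendsto (0 : ℂ)) hB0
    rw [hA0, zero_div] at this
    exact this
  refine (h1.comp tendsto_inv₀_cobounded).congr' ?_
  filter_upwards [Bornology.eventually_ne_cobounded (0 : ℂ)] with w hw
  letI := invertibleOfNonzero hw
  have e1 := Polynomial.eval₂_reflect_mul_pow (RingHom.id ℂ) w N A h.le
  have e2 := Polynomial.eval₂_reflect_mul_pow (RingHom.id ℂ) w N B le_rfl
  rw [invOf_eq_inv, ← Polynomial.eval, ← Polynomial.eval] at e1 e2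
  simp only [Function.comp]
  rw [← e1, ← e2, mul_div_mul_right _ _ (pow_ne_zero N hw)]

theorem bernstein_aux (p g : Polynomial ℂ) (d n : ℕ) (hd : 1 ≤ d) (hpd : p.natDegree = d)
    (hg : g.natDegree ≤ n) (hK : ∀ w, ‖p.eval w‖ ≤ 1 → ‖g.eval w‖ ≤ 1) (w : ℂ)
    (hw : 1 < ‖p.eval w‖) (k : ℕ) :
    (‖g.eval w‖ ^ d / ‖p.eval w‖ ^ n) ^ k ≤ ‖p.eval w‖ := by
  have hdeg : (g ^ (d * k)).natDegree < (p ^ (n * k + 1)).natDegree := by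
    rw [Polynomial.natDegree_pow, Polynomial.natDegree_pow, hpd]
    have : d * k * g.natDegree ≤ d * k * n := Nat.mul_le_mul_left _ hg
    nlinarith
  have ht := (tendsto_eval_div_zero _ _ hdeg).norm
  rw [norm_zero] at ht
  have hev := ht.eventually (ge_mem_nhds one_pos)
  rw [← comap_norm_atTop, eventually_comap] at hev
  obtain ⟨R, hR⟩ := (hev.and (eventually_gt_atTop ‖w‖)).exists
  obtain ⟨hR1, hR2⟩ := hR
  have hpc : Continuous fun z : ℂ => ‖p.eval z‖ := p.continuous.norm
  have hopen : IsOpen {z : ℂ | 1 < ‖p.eval z‖} := isOpen_lt continuous_const hpc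
  have hcl : closure ({z : ℂ | 1 < ‖p.eval z‖} ∩ ball 0 R) ⊆
      {z : ℂ | 1 ≤ ‖p.eval z‖} ∩ closedBall 0 R :=
    closure_minimal (fun z hz => ⟨le_of_lt (show 1 < ‖p.eval z‖ from hz.1), ball_subset_closedBall hz.2⟩)
      ((isClosed_le continuous_const hpc).inter isClosed_closedBall)
  have key := Complex.norm_le_of_forall_mem_frontier_norm_le
    (f := fun z : ℂ => (g ^ (d * k)).eval z / (p ^ (n * k + 1)).eval z)
    (U := {z : ℂ | 1 < ‖p.eval z‖} ∩ ball 0 R) (C := 1)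
    (isBounded_ball.subset inter_subset_right) ?_ ?_
    (z := w) (subset_closure ⟨hw, by simpa using hR2⟩)
  · have hp0 : 0 < ‖p.eval w‖ := by linarith
    simp only [Polynomial.eval_pow, norm_div, norm_pow] at key
    rw [div_le_one (by positivity)] at key
    rw [div_pow, ← pow_mul, ← pow_mul, div_le_iff₀ (by positivity)]
    calc _ ≤ _ := key
      _ = _ := by ring
  · apply DifferentiableOn.diffContOnCl
    apply DifferentiableOn.div
    · exact (Polynomial.differentiable _).differentiableOn
    · exact (Polynomial.differentiable _).differentiableOn
    · intro z hz
      have h1 : 1 ≤ ‖p.eval z‖ := (hcl hz).1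
      rw [Polynomial.eval_pow]
      apply pow_ne_zero
      intro h0
      rw [h0] at h1
      simp at h1
      linarith
  · intro z hz
    have h1 := hcl (frontier_subset_closure hz)
    rw [(hopen.inter isOpen_ball).frontier_eq] at hz
    by_cases hzR : ‖z‖ = R
    · exact hR1 z hzR
    · have h2 : ‖z‖ ≤ R := by simpa using h1.2
      have h3 : ‖p.eval z‖ ≤ 1 := by
        by_contra hcon
        exact hz.2 ⟨not_le.1 hcon, by simpa using lt_of_le_of_ne h2 hzR⟩
      have h4 : ‖p.eval z‖ = 1 := le_antisymm h3 h1.1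
      simp only [Polynomial.eval_pow, norm_div, norm_pow, h4, one_pow, div_one]
      exact pow_le_one₀ (norm_nonneg _) (hK z h3)

theorem bernstein_walsh (p g : Polynomial ℂ) (d n : ℕ) (hd : 1 ≤ d) (hn : 1 ≤ n)
    (hpd : p.natDegree = d)
    (hg : g.natDegree ≤ n) (hK : ∀ w, ‖p.eval w‖ ≤ 1 → ‖g.eval w‖ ≤ 1) (w : ℂ) :
    (n : ℝ)⁻¹ * max (Real.log ‖g.eval w‖) 0 ≤ (d : ℝ)⁻¹ * max (Real.log ‖p.eval w‖) 0 := by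
  have hd' : (0 : ℝ) < d := by exact_mod_cast hd
  have hn' : (0 : ℝ) < n := by exact_mod_cast hn
  rcases le_or_gt ‖p.eval w‖ 1 with hw | hw
  · rw [max_eq_right (Real.log_nonpos (norm_nonneg _) (hK w hw)), mul_zero]
    positivity
  · have h1 : ‖g.eval w‖ ^ d / ‖p.eval w‖ ^ n ≤ 1 := by
      by_contra hcon
      obtain ⟨k, hk⟩ := pow_unbounded_of_one_lt ‖p.eval w‖ (not_le.1 hcon)
      exact absurd (bernstein_aux p g d n hd hpd hg hK w hw k) (not_le.2 hk)
    have hp0 : 0 < ‖p.eval w‖ := by linarith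
    rw [div_le_one (by positivity)] at h1
    have hlp : 0 < Real.log ‖p.eval w‖ := Real.log_pos hw
    rw [max_eq_left hlp.le]
    rcases le_or_gt ‖g.eval w‖ 1 with hgw | hgw
    · rw [max_eq_right (Real.log_nonpos (norm_nonneg _) hgw), mul_zero]
      positivity
    · rw [max_eq_left (Real.log_pos hgw).le]
      have hg0 : 0 < ‖g.eval w‖ := by linarith
      have h2 := Real.log_le_log (by positivity) h1
      rw [Real.log_pow, Real.log_pow] at h2
      rw [inv_mul_eq_div, inv_mul_eq_div, div_le_div_iff₀ hn' hd']
      linarith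

theorem isCompact_sublevel (p : Polynomial ℂ) (h : 1 ≤ p.natDegree) :
    IsCompact {w : ℂ | ‖p.eval w‖ ≤ 1} := by
  have hc : IsClosed {w : ℂ | ‖p.eval w‖ ≤ 1} := isClosed_le p.continuous.norm continuous_const
  have ht := p.tendsto_norm_atTop (Polynomial.natDegree_pos_iff_degree_pos.1 h)
    (z := fun z : ℂ => z) (tendsto_norm_cobounded_atTop)
  have hev := ht.eventually (eventually_gt_atTop 1)
  refine Metric.isCompact_of_isClosed_isBounded hc ?_
  rw [← Bornology.isCobounded_compl_iff]
  refine mem_of_superset hev ?_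
  intro z hz
  simpa using hz

theorem isCompact_crossE (p q : Polynomial ℂ) (hp : 1 ≤ p.natDegree) (hq : 1 ≤ q.natDegree) :
    IsCompact (crossE p q) := by
  have h1 := (isCompact_sublevel p hp).image
    (f := fun w : ℂ => (WithLp.toLp 2 ![w, 0] : EuclideanSpace ℂ (Fin 2))) (by fun_prop)
  have h2 := (isCompact_sublevel q hq).image
    (f := fun w : ℂ => (WithLp.toLp 2 ![0, w] : EuclideanSpace ℂ (Fin 2))) (by fun_prop)
  convert h1.union h2 using 1
  unfold crossE
  congr 1
  · ext v
    constructor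
    · rintro ⟨ha, hb⟩
      refine ⟨v 0, ha, ?_⟩
      ext i
      fin_cases i <;> simp [hb]
    · rintro ⟨w, hw, rfl⟩
      exact ⟨by simpa using hw, by simp⟩
  · ext v
    constructor
    · rintro ⟨ha, hb⟩
      refine ⟨v 1, hb, ?_⟩
      ext i
      fin_cases i <;> simp [ha]
    · rintro ⟨w, hw, rfl⟩
      exact ⟨by simp, by simpa using hw⟩

theorem eval_restrict (F : Fin 2 → Polynomial ℂ) (Q : MvPolynomial (Fin 2) ℂ) (w : ℂ)
    (v : EuclideanSpace ℂ (Fin 2)) (hv : ∀ i, v i = (F i).eval w) :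
    (MvPolynomial.aeval F Q).eval w = evalAt v Q := by
  unfold evalAt
  simp only [hv]
  induction Q using MvPolynomial.induction_on with
  | C a => simp
  | add a b ha hb => simp [ha, hb]
  | mul_X a i ha => simp [ha]

theorem totalDegree_aeval_X_le (p : Polynomial ℂ) (i : Fin 2) :
    (Polynomial.aeval (X i : MvPolynomial (Fin 2) ℂ) p).totalDegree ≤ p.natDegree := by
  rw [Polynomial.aeval_eq_sum_range]
  refine totalDegree_finsetSum_le fun j hj => ?_
  refine (totalDegree_smul_le _ _).trans ?_
  rw [totalDegree_X_pow]
  have := Finset.mem_range.1 hj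
  omega

theorem evalAt_aeval_X (p : Polynomial ℂ) (i : Fin 2) (v : EuclideanSpace ℂ (Fin 2)) :
    evalAt v (Polynomial.aeval (X i : MvPolynomial (Fin 2) ℂ) p) = p.eval (v i) := by
  unfold evalAt
  induction p using Polynomial.induction_on' with
  | add a b ha hb => simp [ha, hb]
  | monomial n a => simp [Polynomial.aeval_monomial]

theorem totalDegree_cross (p q : Polynomial ℂ) (d : ℕ)
    (hpd : p.natDegree = d) (hqd : q.natDegree = d) (hq0 : q.eval 0 = 0) :
    (Polynomial.aeval (X 0 : MvPolynomial (Fin 2) ℂ) p +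
      Polynomial.aeval (X 1 : MvPolynomial (Fin 2) ℂ) q).totalDegree = d := by
  apply le_antisymm
  · refine (totalDegree_add _ _).trans (max_le ?_ ?_)
    · exact (totalDegree_aeval_X_le p 0).trans hpd.le
    · exact (totalDegree_aeval_X_le q 1).trans hqd.le
  · have h := MvPolynomial.aeval_natDegree_le (n := 1) _ (le_refl (Polynomial.aeval (X 0 : MvPolynomial (Fin 2) ℂ) p +
      Polynomial.aeval (X 1 : MvPolynomial (Fin 2) ℂ) q).totalDegree)
      (![Polynomial.X, 0] : Fin 2 → Polynomial ℂ) (by intro i; fin_cases i <;> simp)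
    have e : MvPolynomial.aeval (![Polynomial.X, 0] : Fin 2 → Polynomial ℂ)
        (Polynomial.aeval (X 0 : MvPolynomial (Fin 2) ℂ) p +
      Polynomial.aeval (X 1 : MvPolynomial (Fin 2) ℂ) q) = p := by
      apply Polynomial.funext
      intro w
      rw [eval_restrict _ _ w (WithLp.toLp 2 ![w, 0]) (by intro i; fin_cases i <;> simp)]
      have := evalAt_aeval_X p 0 (WithLp.toLp 2 ![w, 0])
      have h2 := evalAt_aeval_X q 1 (WithLp.toLp 2 ![w, 0])
      unfold evalAt at this h2 ⊢
      rw [map_add, this, h2]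
      simp [hq0]
    rw [e, hpd, mul_one] at h
    exact h

/-- Let `p, q` be nonconstant one-variable polynomials with
`p(0) = q(0) = 0` and `deg p = deg q = d ≥ 1`. With `𝒜 = {(w,z) : wz = 0}` and
`E = (p⁻¹(Δ̄) × {0}) ∪ ({0} × q⁻¹(Δ̄))`, the set `E` is compact and every `(w,z) ∈ 𝒜`
satisfies `V_E(w,z) = (1/d)·log⁺ |p(w) + q(z)|`. -/
theorem statement19 (p q : Polynomial ℂ) (d : ℕ) (hd : 1 ≤ d)
    (hpd : p.natDegree = d) (hqd : q.natDegree = d)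
    (hp0 : p.eval 0 = 0) (hq0 : q.eval 0 = 0) :
    IsCompact (crossE p q) ∧
    ∀ v ∈ crossSet,
      greenV (crossE p q) v =
        ((((d : ℝ))⁻¹ *
          max (Real.log ‖Polynomial.eval (v 0) p + Polynomial.eval (v 1) q‖) 0 : ℝ) : EReal) := by
  refine ⟨isCompact_crossE p q (hpd ▸ hd) (hqd ▸ hd), fun v hv => ?_⟩
  unfold greenV
  apply le_antisymm
  · apply sSup_le
    rintro x ⟨Q, hQ1, hQ2, rfl⟩
    rw [EReal.coe_le_coe_iff]
    rcases mul_eq_zero.1 (show v 0 * v 1 = 0 from hv) with h0 | h1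
    · have hdeg := MvPolynomial.aeval_natDegree_le (n := 1) Q le_rfl
        (![0, Polynomial.X] : Fin 2 → Polynomial ℂ) (by intro i; fin_cases i <;> simp)
      rw [mul_one] at hdeg
      have := bernstein_walsh q _ d _ hd hQ1 hqd hdeg (fun w hw => by
        rw [eval_restrict _ _ w (WithLp.toLp 2 ![0, w]) (by intro i; fin_cases i <;> simp)]
        exact hQ2 _ (Or.inr ⟨by simp, by simpa using hw⟩)) (v 1)
      rw [eval_restrict _ _ (v 1) v (by intro i; fin_cases i <;> simp [h0])] at this
      rwa [h0, hp0, zero_add]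
    · have hdeg := MvPolynomial.aeval_natDegree_le (n := 1) Q le_rfl
        (![Polynomial.X, 0] : Fin 2 → Polynomial ℂ) (by intro i; fin_cases i <;> simp)
      rw [mul_one] at hdeg
      have := bernstein_walsh p _ d _ hd hQ1 hpd hdeg (fun w hw => by
        rw [eval_restrict _ _ w (WithLp.toLp 2 ![w, 0]) (by intro i; fin_cases i <;> simp)]
        exact hQ2 _ (Or.inl ⟨by simpa using hw, by simp⟩)) (v 0)
      rw [eval_restrict _ _ (v 0) v (by intro i; fin_cases i <;> simp [h1])] at this
      rwa [h1, hq0, add_zero]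
  · have hev : ∀ u : EuclideanSpace ℂ (Fin 2),
        evalAt u (Polynomial.aeval (X 0 : MvPolynomial (Fin 2) ℂ) p +
          Polynomial.aeval (X 1 : MvPolynomial (Fin 2) ℂ) q) = p.eval (u 0) + q.eval (u 1) := by
      intro u
      rw [← evalAt_aeval_X p 0, ← evalAt_aeval_X q 1]
      unfold evalAt
      rw [map_add]
    have hdeg := totalDegree_cross p q d hpd hqd hq0
    apply le_sSup
    refine ⟨_, hd.trans hdeg.ge, ?_, ?_⟩
    · intro u hu
      rw [hev]
      rcases hu with ⟨ha, hb⟩ | ⟨ha, hb⟩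
      · rw [hb, hq0, add_zero]
        exact ha
      · rw [ha, hp0, zero_add]
        exact hb
    · rw [hev, hdeg]
end
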